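/- Let s > d/2 and σ ≥ 2, assume the exact solution of the Zakharov system satisfies ‖ψ(t)‖_{s+2+σ} + |||(u(t),u̇(t))|||_{s+σ} ≤ M for 0 ≤ t−t₀ ≤ T with M ≥ 1, and assume the a priori bound ‖φ_n^K‖_s + |||(u_n^K,u̇_n^K)|||_s ≤ 2C₀M on the fully discrete solution for τ ≤ t_n−t₀ ≤ T. Then there is a constant C, depending only on d, s, σ, M, T and c, such that the stability estimate ‖φ̂_{n+1}^K − φ_{n+1}^K‖_s ≤ ‖φ^K(t_n) − φ_n^K‖_s + C τ e_n^K holds for τ ≤ t_n−t₀ ≤ T. -/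

import Mathlib

noncomputable section

namespace Zak

/-- Fourier coefficients of a function on the `d`-dimensional torus `𝕋^d`. -/
abbrev Coef (d : ℕ) := (Fin d → ℤ) → ℂ

/-- Euclidean norm `|j|` of a frequency `j ∈ ℤ^d`. -/
def absZ {d : ℕ} (j : Fin d → ℤ) : ℝ := Real.sqrt (∑ i, ((j i : ℝ)) ^ 2)

/-- Sobolev norm `‖v‖ₛ = (∑_j max(|j|,1)^{2s} |v_j|²)^{1/2}`. -/
def sobNorm {d : ℕ} (s : ℝ) (v : Coef d) : ℝ :=
  Real.sqrt (∑' j : Fin d → ℤ, (max (absZ j) 1) ^ (2 * s) * ‖v j‖ ^ 2)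

/-- Norm `|||(v, v̇)|||ₛ = (‖v‖_{s+1}² + ‖v̇‖ₛ²)^{1/2}` on `H^{s+1} × H^s`. -/
def pairNorm {d : ℕ} (s : ℝ) (v w : Coef d) : ℝ :=
  Real.sqrt (sobNorm (s + 1) v ^ 2 + sobNorm s w ^ 2)

/-- Convolution of Fourier coefficients (= product of the functions). -/
def conv {d : ℕ} (v w : Coef d) : Coef d := fun j => ∑' k : Fin d → ℤ, v k * w (j - k)

/-- Fourier coefficients of the complex conjugate function. -/
def conjC {d : ℕ} (v : Coef d) : Coef d := fun j => (starRingEnd ℂ) (v (-j))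

/-- Fourier coefficients of `|v|² = v ⬝ conj v`. -/
def absSq {d : ℕ} (v : Coef d) : Coef d := conv v (conjC v)

/-- Fourier coefficients of the real part of the function. -/
def reC {d : ℕ} (v : Coef d) : Coef d := fun j => (v j + (starRingEnd ℂ) (v (-j))) / 2

/-- Membership of a frequency in `𝒦 = {-K, …, K-1}^d`. -/
def inK (d K : ℕ) (j : Fin d → ℤ) : Prop := ∀ i, -(K : ℤ) ≤ j i ∧ j i < K

/-- Trigonometric polynomial of degree `K`: only modes in `𝒦` are present. -/
def isTrig (d K : ℕ) (v : Coef d) : Prop := ∀ j, ¬ inK d K j → v j = 0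

/-- The function is real-valued: conjugate-symmetric Fourier coefficients. -/
def isReal {d : ℕ} (v : Coef d) : Prop := ∀ j, v (-j) = (starRingEnd ℂ) (v j)

open Classical in
/-- Trigonometric interpolation `𝓘` of degree `K` at the collocation points
`x_k = kπ/K`, expressed through aliasing of Fourier coefficients. -/
def interp (d K : ℕ) (v : Coef d) : Coef d := fun j =>
  if inK d K j then ∑' m : Fin d → ℤ, v (j + (2 * (K : ℤ)) • m) else 0

/-- Fourier multiplier with symbol `g(|j|)`. -/
def mulOp {d : ℕ} (g : ℝ → ℂ) (v : Coef d) : Coef d := fun j => g (absZ j) * v j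

/-- `sinc ξ = sin ξ / ξ`, `sinc 0 = 1`. -/
def sinc (x : ℝ) : ℝ := if x = 0 then 1 else Real.sin x / x

/-- Convolution powers `v^{*n}` (with `v^{*0} = δ₀`). -/
def convPow {d : ℕ} (v : Coef d) : ℕ → Coef d
  | 0 => fun j => if j = 0 then 1 else 0
  | n + 1 => conv v (convPow v n)

/-- Composition with the exponential: Fourier coefficients of `e^{v}`. -/
def expC {d : ℕ} (v : Coef d) : Coef d :=
  fun j => ∑' n : ℕ, ((n.factorial : ℂ))⁻¹ * convPow v n j

/-- Composition with `ϕ(ξ) = (e^ξ - 1)/ξ = ∑ ξ^n/(n+1)!`. -/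
def phiC {d : ℕ} (v : Coef d) : Coef d :=
  fun j => ∑' n : ℕ, (((n + 1).factorial : ℂ))⁻¹ * convPow v n j

/-- The wave propagator matrix
`R(t) = [[cos(tΩ), t sinc(tΩ)], [-Ω sin(tΩ), cos(tΩ)]]`. -/
def Rop {d : ℕ} (t : ℝ) (p : Coef d × Coef d) : Coef d × Coef d :=
  (fun j => ((Real.cos (t * absZ j) : ℝ) : ℂ) * p.1 j
      + ((t * sinc (t * absZ j) : ℝ) : ℂ) * p.2 j,
   fun j => -(((absZ j * Real.sin (t * absZ j) : ℝ)) : ℂ) * p.1 j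
      + ((Real.cos (t * absZ j) : ℝ) : ℂ) * p.2 j)

/-- The operator `(Ω² ϕ(iτΩ²) + 1)⁻¹`, multiplying the `j`-th Fourier coefficient
by `iτ/(e^{iτ|j|²} - 1 + iτ)`. -/
def poissonInv (d : ℕ) (τ : ℝ) (v : Coef d) : Coef d :=
  fun j => (Complex.I * (τ : ℂ) /
      (Complex.exp (Complex.I * (τ : ℂ) * ((absZ j : ℝ) : ℂ) ^ 2) - 1 + Complex.I * (τ : ℂ))) * v j

/-- The operator `(Ω² + 1)⁻¹ = (-Δ + 1)⁻¹`. -/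
def laplInv (d : ℕ) (v : Coef d) : Coef d :=
  fun j => ((((absZ j) ^ 2 + 1 : ℝ)) : ℂ)⁻¹ * v j

/-- The free Schrödinger propagator `e^{-iτΩ²} = e^{iτΔ}`. -/
def freeOp {d : ℕ} (τ : ℝ) : Coef d → Coef d :=
  mulOp (fun x => Complex.exp (-Complex.I * (τ : ℂ) * ((x : ℂ)) ^ 2))

/-- The inverse free propagator `e^{iτΩ²}`. -/
def freeOpInv {d : ℕ} (τ : ℝ) : Coef d → Coef d :=
  mulOp (fun x => Complex.exp (Complex.I * (τ : ℂ) * ((x : ℂ)) ^ 2))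

/-- The operator `sinc(τΩ)`. -/
def sincOp {d : ℕ} (τ : ℝ) : Coef d → Coef d := mulOp (fun x => ((sinc (τ * x) : ℝ) : ℂ))

/-- The operator `sinc(τΩ/2)²`. -/
def sincHalfSqOp {d : ℕ} (τ : ℝ) : Coef d → Coef d :=
  mulOp (fun x => ((sinc (τ * x / 2) ^ 2 : ℝ) : ℂ))

/-- The operator `sinc(τΩ) - 1`. -/
def sincm1Op {d : ℕ} (τ : ℝ) : Coef d → Coef d := mulOp (fun x => ((sinc (τ * x) - 1 : ℝ) : ℂ))

/-- The Zakharov system in first-order form, `i∂_tψ = -Δψ + uψ`, `∂_t u = u̇`,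
`∂_t u̇ = Δu + Δ|ψ|²`, with `u`, `u̇` real-valued, formulated mode-wise for the
Fourier coefficients. -/
def ZakSol (d : ℕ) (ψ u ud : ℝ → Coef d) : Prop :=
  (∀ t j, HasDerivAt (fun r => ψ r j)
      (-Complex.I * (((absZ j ^ 2 : ℝ) : ℂ) * ψ t j + conv (u t) (ψ t) j)) t) ∧
  (∀ t j, HasDerivAt (fun r => u r j) (ud t j) t) ∧
  (∀ t j, HasDerivAt (fun r => ud r j)
      (-((absZ j ^ 2 : ℝ) : ℂ) * (u t j + absSq (ψ t) j)) t) ∧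
  (∀ t, isReal (u t)) ∧ (∀ t, isReal (ud t))

/-- The Fourier collocation semi-discretization in space of the Zakharov system:
`i∂_tψ^K = -Δψ^K + 𝓘(u^K ψ^K)`, `∂_t u^K = u̇^K`, `∂_t u̇^K = Δu^K + Δ𝓘(|ψ^K|²)`
for trigonometric polynomials of degree `K`. -/
def ZakSolK (d K : ℕ) (ψ u ud : ℝ → Coef d) : Prop :=
  (∀ t, isTrig d K (ψ t) ∧ isTrig d K (u t) ∧ isTrig d K (ud t)) ∧
  (∀ t j, HasDerivAt (fun r => ψ r j)
      (-Complex.I * (((absZ j ^ 2 : ℝ) : ℂ) * ψ t j + interp d K (conv (u t) (ψ t)) j)) t) ∧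
  (∀ t j, HasDerivAt (fun r => u r j) (ud t j) t) ∧
  (∀ t j, HasDerivAt (fun r => ud r j)
      (-((absZ j ^ 2 : ℝ) : ℂ) * (u t j + interp d K (absSq (ψ t)) j)) t)

/-- Interpolated initial values `ψ^K(t₀) = 𝓘(ψ(t₀))` etc. -/
def initK (d K : ℕ) (t₀ : ℝ) (ψ u ud ψK uK udK : ℝ → Coef d) : Prop :=
  ψK t₀ = interp d K (ψ t₀) ∧ uK t₀ = interp d K (u t₀) ∧ udK t₀ = interp d K (ud t₀)

/-- The new variable `φ = ∂_tψ`, expressed via the Schrödinger equation. -/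
def phiEx (d : ℕ) (ψ u : ℝ → Coef d) : ℝ → Coef d :=
  fun t j => -Complex.I * (((absZ j ^ 2 : ℝ) : ℂ) * ψ t j + conv (u t) (ψ t) j)

/-- The semi-discrete new variable `φ^K = ∂_tψ^K`, expressed via the semi-discrete
Schrödinger equation. -/
def phiK (d K : ℕ) (ψ u : ℝ → Coef d) : ℝ → Coef d :=
  fun t j => -Complex.I * (((absZ j ^ 2 : ℝ) : ℂ) * ψ t j + interp d K (conv (u t) (ψ t)) j)

/-- Regularity assumption `‖ψ(t)‖_{s+2+σ} + |||(u(t),u̇(t))|||_{s+σ} ≤ M` on `[t₀, t₀+T]`. -/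
def regBound (d : ℕ) (s σ M T t₀ : ℝ) (ψ u ud : ℝ → Coef d) : Prop :=
  ∀ t, t₀ ≤ t → t ≤ t₀ + T → sobNorm (s + 2 + σ) (ψ t) + pairNorm (s + σ) (u t) (ud t) ≤ M

/-- The CFL-type step-size restriction `d τ K² ≤ c`. -/
def CFL (d K : ℕ) (τ c : ℝ) : Prop := (d : ℝ) * τ * (K : ℝ) ^ 2 ≤ c

/-- The semi-discretization error quantity
`e(t) = sup_{t₀ ≤ t' ≤ t} (‖φ(t')-φ^K(t')‖ₛ + |||(u,u̇)(t') - (u^K,u̇^K)(t')|||ₛ)`. -/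
def errSemi (d K : ℕ) (s t₀ : ℝ) (ψ u ud ψK uK udK : ℝ → Coef d) (t : ℝ) : ℝ :=
  sSup ((fun r =>
    sobNorm s (phiEx d ψ u r - phiK d K ψK uK r)
      + pairNorm s (u r - uK r) (ud r - udK r)) '' Set.Icc t₀ t)

/-- `v_{n+1}^K = sinc(τΩ) u_n^K + (τ/2) sinc(τΩ/2)² u̇_n^K + (sinc(τΩ)-1) 𝓘(|ψ_n^K|²)`. -/
def vOrig (d K : ℕ) (τ : ℝ) (u ud ψ : Coef d) : Coef d :=
  sincOp τ u + ((τ / 2 : ℝ) : ℂ) • sincHalfSqOp τ ud + sincm1Op τ (interp d K (absSq ψ))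

/-- `ψ_{n+1}^K = e^{-iτΩ²} 𝓘(e^{-iτ v} ψ_n^K)`. -/
def psiStep (d K : ℕ) (τ : ℝ) (v ψ : Coef d) : Coef d :=
  freeOp τ (interp d K (conv (expC ((-Complex.I * (τ : ℂ)) • v)) ψ))

/-- `(u_{n+1}, u̇_{n+1}) = R(τ)(u_n, u̇_n) + (R(τ)-1)(q, 0)`. -/
def uStep {d : ℕ} (τ : ℝ) (u ud q : Coef d) : Coef d × Coef d :=
  ((Rop τ (u, ud)).1 + (Rop τ (q, 0)).1 - q, (Rop τ (u, ud)).2 + (Rop τ (q, 0)).2)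

/-- The Lie–Trotter splitting method of Jin, Markowich and Zheng. -/
def LieTrotter (d K : ℕ) (τ : ℝ) (ψn un udn : ℕ → Coef d) : Prop :=
  ∀ n : ℕ,
    ψn (n + 1) = psiStep d K τ (vOrig d K τ (un n) (udn n) (ψn n)) (ψn n) ∧
    un (n + 1) = (uStep τ (un n) (udn n) (interp d K (absSq (ψn n)))).1 ∧
    udn (n + 1) = (uStep τ (un n) (udn n) (interp d K (absSq (ψn n)))).2

/-- Interpolated starting values for the fully discrete method. -/
def initFull (d K : ℕ) (t₀ : ℝ) (ψ u ud : ℝ → Coef d) (ψn un udn : ℕ → Coef d) : Prop :=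
  ψn 0 = interp d K (ψ t₀) ∧ un 0 = interp d K (u t₀) ∧ udn 0 = interp d K (ud t₀)

/-- Discrete new variable `φ_n^K = (ψ_n^K - ψ_{n-1}^K)/τ`. -/
def phin {d : ℕ} (τ : ℝ) (ψn : ℕ → Coef d) (n : ℕ) : Coef d :=
  ((τ : ℂ))⁻¹ • (ψn n - ψn (n - 1))

/-- `v = sinc(τΩ) u - (τ/2) sinc(τΩ/2)² u̇ + (sinc(τΩ)-1) 𝓘(|p|²)` (new variables). -/
def vNew (d K : ℕ) (τ : ℝ) (u ud p : Coef d) : Coef d :=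
  sincOp τ u - ((τ / 2 : ℝ) : ℂ) • sincHalfSqOp τ ud + sincm1Op τ (interp d K (absSq p))

/-- `w = sinc(τΩ/2)² u̇ + (sinc(τΩ)-1) 𝓘(Re((p_cur + p_prev) conj φ))`. -/
def wNew (d K : ℕ) (τ : ℝ) (ud pcur pprev φ : Coef d) : Coef d :=
  sincHalfSqOp τ ud + sincm1Op τ (interp d K (reC (conv (pcur + pprev) (conjC φ))))

/-- One step of the method in the new variables:
`φ ↦ e^{-iτΩ²} 𝓘(e^{-iτv} (φ - iτ w ϕ(-iτ²w) p))`. -/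
def phiStepNew (d K : ℕ) (τ : ℝ) (v w φ p : Coef d) : Coef d :=
  freeOp τ (interp d K (conv (expC ((-Complex.I * (τ : ℂ)) • v))
    (φ - (Complex.I * (τ : ℂ)) • conv w (conv (phiC ((-Complex.I * (τ : ℂ) ^ 2) • w)) p))))

/-- `ψ_P = (Ω²ϕ(iτΩ²)+1)⁻¹ 𝓘(iφ + p - v ϕ(iτv) e^{iτΩ²} p)`. -/
def psiPNew (d K : ℕ) (τ : ℝ) (φ p v : Coef d) : Coef d :=
  poissonInv d τ (interp d K (Complex.I • φ + p -
    conv v (conv (phiC ((Complex.I * (τ : ℂ)) • v)) (freeOpInv τ p))))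

/-- Discrete new variable `v_n^K`. -/
def vn (d K : ℕ) (τ : ℝ) (ψn un udn : ℕ → Coef d) (n : ℕ) : Coef d :=
  vNew d K τ (un n) (udn n) (ψn (n - 1))

/-- Discrete new variable `w_n^K`. -/
def wn (d K : ℕ) (τ : ℝ) (ψn un udn : ℕ → Coef d) (n : ℕ) : Coef d :=
  wNew d K τ (udn n) (ψn n) (ψn (n - 1)) (phin τ ψn n)

/-- Discrete new variable `ψ_{P,n}^K` (with `ψ_{P,0}^K = ψ₀^K`). -/
def psiPn (d K : ℕ) (τ : ℝ) (ψn un udn : ℕ → Coef d) (n : ℕ) : Coef d :=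
  if n = 0 then ψn 0 else
    psiPNew d K τ (phin τ ψn n) (ψn n) (vn d K τ ψn un udn n)

/-- Intermediate quantity `ψ̂_{I,n}^K = ψ₀^K + τ(φ^K(t₁) + … + φ^K(t_n))`. -/
def psiIhat (d K : ℕ) (τ t₀ : ℝ) (ψK uK : ℝ → Coef d) (n : ℕ) : Coef d :=
  ψK t₀ + (τ : ℂ) • ∑ m ∈ Finset.range n, phiK d K ψK uK (t₀ + ((m : ℝ) + 1) * τ)

/-- Intermediate quantity `v̂_n^K`. -/
def vhat (d K : ℕ) (τ t₀ : ℝ) (ψK uK udK : ℝ → Coef d) (n : ℕ) : Coef d :=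
  vNew d K τ (uK (t₀ + (n : ℝ) * τ)) (udK (t₀ + (n : ℝ) * τ)) (psiIhat d K τ t₀ ψK uK (n - 1))

/-- Intermediate quantity `ŵ_n^K`. -/
def what (d K : ℕ) (τ t₀ : ℝ) (ψK uK udK : ℝ → Coef d) (n : ℕ) : Coef d :=
  wNew d K τ (udK (t₀ + (n : ℝ) * τ)) (psiIhat d K τ t₀ ψK uK n)
    (psiIhat d K τ t₀ ψK uK (n - 1)) (phiK d K ψK uK (t₀ + (n : ℝ) * τ))

/-- Intermediate quantity `φ̂_{n+1}^K` (as a function of `n`). -/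
def phihatSucc (d K : ℕ) (τ t₀ : ℝ) (ψK uK udK : ℝ → Coef d) (n : ℕ) : Coef d :=
  phiStepNew d K τ (vhat d K τ t₀ ψK uK udK n) (what d K τ t₀ ψK uK udK n)
    (phiK d K ψK uK (t₀ + (n : ℝ) * τ)) (psiIhat d K τ t₀ ψK uK n)

/-- Intermediate quantity `ψ̂_{P,n}^K` (with `ψ̂_{P,0}^K = ψ₀^K`). -/
def psiPhat (d K : ℕ) (τ t₀ : ℝ) (ψK uK udK : ℝ → Coef d) (n : ℕ) : Coef d :=
  if n = 0 then ψK t₀ else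
    psiPNew d K τ (phiK d K ψK uK (t₀ + (n : ℝ) * τ)) (psiIhat d K τ t₀ ψK uK n)
      (vhat d K τ t₀ ψK uK udK n)

/-- Intermediate quantity `(û_{n+1}^K, û̇_{n+1}^K)` (as a function of `n`). -/
def uhatSucc (d K : ℕ) (τ t₀ : ℝ) (ψK uK udK : ℝ → Coef d) (n : ℕ) : Coef d × Coef d :=
  uStep τ (uK (t₀ + (n : ℝ) * τ)) (udK (t₀ + (n : ℝ) * τ))
    (interp d K (absSq (psiPhat d K τ t₀ ψK uK udK n)))

/-- The fully discrete error quantity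
`e_n^K = max_{1 ≤ j ≤ n} (‖φ^K(t_j) - φ_j^K‖ₛ + |||(u^K,u̇^K)(t_j) - (u_j^K,u̇_j^K)|||ₛ)`,
with `e₀^K = 0`. -/
def errFull (d K : ℕ) (s τ t₀ : ℝ) (ψK uK udK : ℝ → Coef d)
    (ψn un udn : ℕ → Coef d) (n : ℕ) : ℝ :=
  sSup ((fun m : ℕ =>
    sobNorm s (phiK d K ψK uK (t₀ + (m : ℝ) * τ) - phin τ ψn m)
      + pairNorm s (uK (t₀ + (m : ℝ) * τ) - un m) (udK (t₀ + (m : ℝ) * τ) - udn m))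
    '' Set.Icc 1 n)

/-- Higher-order regularity bound on the semi-discrete solution (with constant `C₀`). -/
def regHighK (d K : ℕ) (s C₀ T t₀ : ℝ) (ψK uK udK : ℝ → Coef d) : Prop :=
  ∀ t, t₀ ≤ t → t ≤ t₀ + T →
    sobNorm (s + 4) (ψK t) + pairNorm (s + 2) (uK t) (udK t)
      + sobNorm (s + 2) (phiK d K ψK uK t) ≤ C₀

/-- A priori bound `‖φ_n^K‖ₛ + |||(u_n^K,u̇_n^K)|||ₛ ≤ B` for `τ ≤ t_n - t₀ ≤ T`
on the fully discrete solution. -/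
def aprioriFull {d : ℕ} (s B T τ : ℝ) (ψn un udn : ℕ → Coef d) : Prop :=
  ∀ n : ℕ, 1 ≤ n → (n : ℝ) * τ ≤ T →
    sobNorm s (phin τ ψn n) + pairNorm s (un n) (udn n) ≤ B

section Part1
open scoped ENNReal

/-! ### Weights -/

def wt {d : ℕ} (j : Fin d → ℤ) : ℝ := max (absZ j) 1

lemma one_le_wt {d : ℕ} (j : Fin d → ℤ) : 1 ≤ wt j := le_max_right _ _
lemma wt_pos {d : ℕ} (j : Fin d → ℤ) : 0 < wt j := lt_of_lt_of_le one_pos (one_le_wt j)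

lemma absZ_nonneg {d : ℕ} (j : Fin d → ℤ) : 0 ≤ absZ j := Real.sqrt_nonneg _

lemma absZ_eq_norm {d : ℕ} (j : Fin d → ℤ) :
    absZ j = ‖(WithLp.toLp 2 (fun i => (j i : ℝ)) : EuclideanSpace ℝ (Fin d))‖ := by
  rw [EuclideanSpace.norm_eq]
  simp [absZ]

lemma absZ_add_le {d : ℕ} (j k : Fin d → ℤ) : absZ (j + k) ≤ absZ j + absZ k := by
  rw [absZ_eq_norm, absZ_eq_norm, absZ_eq_norm]
  refine le_trans (le_of_eq ?_) (norm_add_le _ _)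
  congr 1
  ext i
  simp

lemma absZ_neg {d : ℕ} (j : Fin d → ℤ) : absZ (-j) = absZ j := by
  simp [absZ]

lemma wt_neg {d : ℕ} (j : Fin d → ℤ) : wt (-j) = wt j := by
  simp [wt, absZ_neg]

lemma wt_le {d : ℕ} (j k : Fin d → ℤ) : wt j ≤ wt k + wt (j - k) := by
  have h := absZ_add_le k (j - k)
  rw [add_sub_cancel] at h
  have h1 : absZ k ≤ wt k := le_max_left _ _
  have h2 : absZ (j - k) ≤ wt (j - k) := le_max_left _ _
  have h3 := one_le_wt k
  have h4 := one_le_wt (j - k)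
  exact max_le (by linarith) (by linarith)

def W {d : ℕ} (s : ℝ) (j : Fin d → ℤ) : ℝ≥0∞ := ENNReal.ofReal (wt j ^ (2 * s))

lemma W_ne_top {d : ℕ} (s : ℝ) (j : Fin d → ℤ) : W s j ≠ ⊤ := ENNReal.ofReal_ne_top
lemma W_ne_zero {d : ℕ} (s : ℝ) (j : Fin d → ℤ) : W s j ≠ 0 := by
  have := Real.rpow_pos_of_pos (wt_pos j) (2 * s)
  simpa [W] using this
lemma W_neg {d : ℕ} (s : ℝ) (j : Fin d → ℤ) : W s (-j) = W s j := by simp [W, wt_neg]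

lemma one_le_W {d : ℕ} {s : ℝ} (hs : 0 ≤ s) (j : Fin d → ℤ) : 1 ≤ W s j := by
  rw [W, ENNReal.one_le_ofReal]
  exact Real.one_le_rpow (one_le_wt j) (by linarith)

lemma W_mono {d : ℕ} {s t : ℝ} (hs : s ≤ t) (j : Fin d → ℤ) : W s j ≤ W t j := by
  apply ENNReal.ofReal_le_ofReal
  exact Real.rpow_le_rpow_of_exponent_le (one_le_wt j) (by linarith)

lemma W_le {d : ℕ} {s : ℝ} (hs : 0 ≤ s) (j k : Fin d → ℤ) :
    W s j ≤ ENNReal.ofReal (2 ^ (2 * s)) * (W s k + W s (j - k)) := by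
  rw [W, W, W, ← ENNReal.ofReal_add (Real.rpow_nonneg (wt_pos _).le _)
    (Real.rpow_nonneg (wt_pos _).le _), ← ENNReal.ofReal_mul (by positivity)]
  apply ENNReal.ofReal_le_ofReal
  have hk := wt_pos k
  have hjk := wt_pos (j - k)
  have h2 : (0 : ℝ) ≤ 2 * s := by linarith
  have hk' := Real.rpow_nonneg hk.le (2 * s)
  have hjk' := Real.rpow_nonneg hjk.le (2 * s)
  have h20 : (0 : ℝ) ≤ 2 ^ (2 * s) := by positivity
  rcases le_total (wt k) (wt (j - k)) with h | h
  · calc wt j ^ (2 * s) ≤ (2 * wt (j - k)) ^ (2 * s) :=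
          Real.rpow_le_rpow (wt_pos j).le (by linarith [wt_le j k]) h2
      _ = 2 ^ (2 * s) * wt (j - k) ^ (2 * s) := Real.mul_rpow (by norm_num) hjk.le
      _ ≤ _ := by gcongr; linarith
  · calc wt j ^ (2 * s) ≤ (2 * wt k) ^ (2 * s) :=
          Real.rpow_le_rpow (wt_pos j).le (by linarith [wt_le j k]) h2
      _ = 2 ^ (2 * s) * wt k ^ (2 * s) := Real.mul_rpow (by norm_num) hk.le
      _ ≤ _ := by gcongr; linarith

/-- `∑ W⁻¹`. -/
def SW (d : ℕ) (s : ℝ) : ℝ≥0∞ := ∑' j : Fin d → ℤ, (W s j)⁻¹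

lemma SW_ne_top {d : ℕ} {s : ℝ} (hs : (d : ℝ) / 2 < s) : SW d s ≠ ⊤ := by
  classical
  have hs0 : 0 < s := lt_of_le_of_lt (by positivity) hs
  let b := Pi.basisFun ℝ (Fin d)
  let L : Submodule ℤ (Fin d → ℝ) := Submodule.span ℤ (Set.range b)
  have hrank : Module.finrank ℤ L = d := by
    have := ZLattice.rank ℝ L
    rw [this]; simp
  have hsum : Summable fun z : L => ‖z‖ ^ (-(2 * s)) :=
    ZLattice.summable_norm_rpow L _ (by rw [hrank]; linarith)
  have hmem : ∀ j : Fin d → ℤ, (fun i => (j i : ℝ)) ∈ L := by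
    intro j
    have : (fun i => (j i : ℝ)) = ∑ i, (j i) • b i := by
      ext k
      simp [b, Finset.sum_apply, Pi.single_apply]
    rw [this]
    exact Submodule.sum_mem _ fun i _ => Submodule.smul_mem _ _ (Submodule.subset_span ⟨i, rfl⟩)
  let ι : (Fin d → ℤ) → L := fun j => ⟨_, hmem j⟩
  have hinj : Function.Injective ι := by
    intro j k h
    have h' := congrArg Subtype.val h
    ext i
    have := congrFun h' i
    simpa [ι] using this
  have hsum2 : Summable fun j : Fin d → ℤ => ‖ι j‖ ^ (-(2 * s)) := hsum.comp_injective hinj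
  have hsum3 : Summable fun j : Fin d → ℤ => ‖ι j‖ ^ (-(2 * s)) + if j = 0 then (1 : ℝ) else 0 :=
    hsum2.add (summable_of_ne_finset_zero (s := {0}) (by intro j hj; simp at hj; simp [hj]))
  have key : ∀ j : Fin d → ℤ, (W s j)⁻¹ ≤
      ENNReal.ofReal (‖ι j‖ ^ (-(2 * s)) + if j = 0 then (1 : ℝ) else 0) := by
    intro j
    rw [W, ← ENNReal.ofReal_inv_of_pos (Real.rpow_pos_of_pos (wt_pos j) _),
      ← Real.rpow_neg (wt_pos j).le]
    apply ENNReal.ofReal_le_ofReal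
    by_cases hj : j = 0
    · have : wt j ^ (-(2 * s)) ≤ 1 :=
        Real.rpow_le_one_of_one_le_of_nonpos (one_le_wt j) (by linarith)
      have h0 : 0 ≤ ‖ι j‖ ^ (-(2 * s)) := Real.rpow_nonneg (norm_nonneg _) _
      simp only [hj, if_true]
      rw [hj] at this h0
      linarith
    · simp only [hj, if_false, add_zero]
      have hpos : 0 < ‖ι j‖ := by
        rw [norm_pos_iff]
        intro h
        apply hj
        apply hinj
        rw [h]
        ext i
        simp [ι]
      apply Real.rpow_le_rpow_of_nonpos hpos _ (by linarith)
      refine le_trans ?_ (le_max_left _ _)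
      change ‖(fun i => (j i : ℝ))‖ ≤ _
      rw [pi_norm_le_iff_of_nonneg (absZ_nonneg j)]
      intro i
      rw [absZ, Real.norm_eq_abs, ← Real.sqrt_sq_eq_abs]
      apply Real.sqrt_le_sqrt
      exact Finset.single_le_sum (f := fun i => ((j i : ℝ)) ^ 2) (fun i _ => sq_nonneg _)
        (Finset.mem_univ i)
  refine ne_top_of_le_ne_top ?_ (ENNReal.tsum_le_tsum key)
  exact hsum3.tsum_ofReal_ne_top
end Part1

section Part2
open scoped ENNReal

/-- Squared Sobolev norm with values in `[0,∞]`. -/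
def H {d : ℕ} (s : ℝ) (v : Coef d) : ℝ≥0∞ := ∑' j, W s j * ‖v j‖ₑ ^ 2

lemma sobNorm_eq {d : ℕ} (s : ℝ) (v : Coef d) : sobNorm s v = Real.sqrt (H s v).toReal := by
  rw [sobNorm, H, ENNReal.tsum_toReal_eq]
  · congr 1
    apply tsum_congr
    intro j
    rw [ENNReal.toReal_mul, W, ENNReal.toReal_ofReal (Real.rpow_nonneg (wt_pos j).le _)]
    simp [wt]
  · intro j
    exact ENNReal.mul_ne_top (W_ne_top s j) (by simp)

lemma sobNorm_nonneg {d : ℕ} (s : ℝ) (v : Coef d) : 0 ≤ sobNorm s v := Real.sqrt_nonneg _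

lemma sobNorm_le_of_H {d : ℕ} {s : ℝ} {v : Coef d} {C : ℝ} (hC : 0 ≤ C)
    (h : H s v ≤ ENNReal.ofReal (C ^ 2)) : sobNorm s v ≤ C := by
  rw [sobNorm_eq]
  apply Real.sqrt_le_iff.2 ⟨hC, ?_⟩
  have := ENNReal.toReal_mono ENNReal.ofReal_ne_top h
  rwa [ENNReal.toReal_ofReal (by positivity)] at this

lemma H_eq_of_ne_top {d : ℕ} {s : ℝ} {v : Coef d} (h : H s v ≠ ⊤) :
    H s v = ENNReal.ofReal (sobNorm s v ^ 2) := by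
  rw [sobNorm_eq, Real.sq_sqrt ENNReal.toReal_nonneg, ENNReal.ofReal_toReal h]

lemma enorm_tsum_le' {ι : Type*} (f : ι → ℂ) : ‖∑' i, f i‖ₑ ≤ ∑' i, ‖f i‖ₑ := by
  by_cases h : Summable f
  · by_cases h2 : ∑' i, ‖f i‖ₑ = ⊤
    · rw [h2]; exact le_top
    · have h3 : Summable fun i => ‖f i‖ := by
        have := ENNReal.summable_toReal h2
        simpa using this
      rw [← ofReal_norm]
      calc ENNReal.ofReal ‖∑' i, f i‖ ≤ ENNReal.ofReal (∑' i, ‖f i‖) :=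
            ENNReal.ofReal_le_ofReal (norm_tsum_le_tsum_norm h3)
        _ = ∑' i, ‖f i‖ₑ := by
            rw [ENNReal.ofReal_tsum_of_nonneg (fun _ => norm_nonneg _) h3]
            simp
  · rw [tsum_eq_zero_of_not_summable h]; simp

lemma tsum_mul_sq_le {ι : Type*} (a b : ι → ℝ≥0∞) :
    (∑' i, a i * b i) ^ 2 ≤ (∑' i, a i ^ 2) * ∑' i, b i ^ 2 := by
  have key : ∀ t : Finset ι, (∑ i ∈ t, a i * b i) ≤
      ((∑' i, a i ^ 2) * ∑' i, b i ^ 2) ^ (1 / 2 : ℝ) := by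
    intro t
    have := ENNReal.inner_le_Lp_mul_Lq t a b (p := 2) (q := 2) Real.HolderConjugate.two_two
    refine this.trans ?_
    rw [← ENNReal.mul_rpow_of_nonneg _ _ (by norm_num)]
    apply ENNReal.rpow_le_rpow _ (by norm_num)
    simp only [ENNReal.rpow_two]
    gcongr
    · exact ENNReal.sum_le_tsum _
    · exact ENNReal.sum_le_tsum _
  have h2 : (∑' i, a i * b i) ≤ ((∑' i, a i ^ 2) * ∑' i, b i ^ 2) ^ (1 / 2 : ℝ) := by
    rw [ENNReal.tsum_eq_iSup_sum]
    exact iSup_le key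
  calc (∑' i, a i * b i) ^ 2 ≤ (((∑' i, a i ^ 2) * ∑' i, b i ^ 2) ^ (1 / 2 : ℝ)) ^ 2 := by gcongr
    _ = _ := by
      rw [← ENNReal.rpow_two, ← ENNReal.rpow_mul]; norm_num

/-- weighted Cauchy-Schwarz -/
lemma enorm_tsum_sq_le {ι : Type*} (f : ι → ℂ) (c : ι → ℝ≥0∞) (h0 : ∀ i, c i ≠ 0)
    (ht : ∀ i, c i ≠ ⊤) :
    ‖∑' i, f i‖ₑ ^ 2 ≤ (∑' i, (c i)⁻¹) * ∑' i, c i * ‖f i‖ₑ ^ 2 := by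
  have h := tsum_mul_sq_le (fun i => (c i) ^ (-(1 / 2) : ℝ))
    (fun i => (c i) ^ (1 / 2 : ℝ) * ‖f i‖ₑ)
  have e1 : ∀ i, (c i) ^ (-(1 / 2) : ℝ) * ((c i) ^ (1 / 2 : ℝ) * ‖f i‖ₑ) = ‖f i‖ₑ := by
    intro i
    rw [← mul_assoc, ← ENNReal.rpow_add _ _ (h0 i) (ht i)]
    simp
  have e2 : ∀ i, ((c i) ^ (-(1 / 2) : ℝ)) ^ 2 = (c i)⁻¹ := by
    intro i
    rw [← ENNReal.rpow_two, ← ENNReal.rpow_mul, ← ENNReal.rpow_neg_one]; norm_num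
  have e3 : ∀ i, ((c i) ^ (1 / 2 : ℝ) * ‖f i‖ₑ) ^ 2 = c i * ‖f i‖ₑ ^ 2 := by
    intro i
    rw [mul_pow]
    congr 1
    rw [← ENNReal.rpow_two, ← ENNReal.rpow_mul]; norm_num
  simp only [e1, e2, e3] at h
  refine le_trans ?_ h
  gcongr
  exact enorm_tsum_le' f

def Aconv (d : ℕ) (s : ℝ) : ℝ≥0∞ := ENNReal.ofReal (2 ^ (2 * s)) * (SW d s + SW d s)

lemma tsum_sub_left {d : ℕ} (j : Fin d → ℤ) (g : (Fin d → ℤ) → ℝ≥0∞) :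
    ∑' k, g (j - k) = ∑' k, g k := (Equiv.subLeft j).tsum_eq g

lemma tsum_sub_right {d : ℕ} (k : Fin d → ℤ) (g : (Fin d → ℤ) → ℝ≥0∞) :
    ∑' j, g (j - k) = ∑' j, g j := (Equiv.subRight k).tsum_eq g

lemma W_conv {d : ℕ} {s : ℝ} (hs : 0 ≤ s) (j : Fin d → ℤ) :
    W s j * ∑' k, (W s k * W s (j - k))⁻¹ ≤ Aconv d s := by
  have h1 : ∀ k, W s j * (W s k * W s (j - k))⁻¹ ≤
      ENNReal.ofReal (2 ^ (2 * s)) * ((W s (j - k))⁻¹ + (W s k)⁻¹) := by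
    intro k
    rw [ENNReal.mul_inv (Or.inl (W_ne_zero s k)) (Or.inl (W_ne_top s k))]
    calc W s j * ((W s k)⁻¹ * (W s (j - k))⁻¹)
        ≤ ENNReal.ofReal (2 ^ (2 * s)) * (W s k + W s (j - k)) *
          ((W s k)⁻¹ * (W s (j - k))⁻¹) := by gcongr; exact W_le hs j k
      _ = ENNReal.ofReal (2 ^ (2 * s)) * ((W s k * (W s k)⁻¹) * (W s (j - k))⁻¹
          + (W s (j - k) * (W s (j - k))⁻¹) * (W s k)⁻¹) := by ring
      _ = _ := by
        rw [ENNReal.mul_inv_cancel (W_ne_zero s k) (W_ne_top s k),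
          ENNReal.mul_inv_cancel (W_ne_zero s (j - k)) (W_ne_top s (j - k)), one_mul, one_mul]
  rw [← ENNReal.tsum_mul_left]
  refine (ENNReal.tsum_le_tsum h1).trans ?_
  rw [ENNReal.tsum_mul_left, ENNReal.tsum_add, tsum_sub_left j (fun k => (W s k)⁻¹)]
  exact le_rfl

lemma H_conv {d : ℕ} {s : ℝ} (hs : 0 ≤ s) (v w : Coef d) :
    H s (conv v w) ≤ Aconv d s * (H s v * H s w) := by
  have h1 : ∀ j, W s j * ‖conv v w j‖ₑ ^ 2 ≤
      Aconv d s * ∑' k, (W s k * ‖v k‖ₑ ^ 2) * (W s (j - k) * ‖w (j - k)‖ₑ ^ 2) := by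
    intro j
    have h := enorm_tsum_sq_le (fun k => v k * w (j - k)) (fun k => W s k * W s (j - k))
      (fun k => mul_ne_zero (W_ne_zero s k) (W_ne_zero s _))
      (fun k => ENNReal.mul_ne_top (W_ne_top s k) (W_ne_top s _))
    calc W s j * ‖conv v w j‖ₑ ^ 2 ≤ W s j * ((∑' k, (W s k * W s (j - k))⁻¹) *
          ∑' k, (W s k * W s (j - k)) * ‖v k * w (j - k)‖ₑ ^ 2) := by
            gcongr; exact h
      _ = (W s j * ∑' k, (W s k * W s (j - k))⁻¹) *
          ∑' k, (W s k * W s (j - k)) * ‖v k * w (j - k)‖ₑ ^ 2 := by ring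
      _ ≤ Aconv d s * ∑' k, (W s k * W s (j - k)) * ‖v k * w (j - k)‖ₑ ^ 2 := by
            gcongr; exact W_conv hs j
      _ = _ := by
            congr 1
            apply tsum_congr
            intro k
            rw [enorm_mul]; ring
  rw [H]
  refine (ENNReal.tsum_le_tsum h1).trans ?_
  rw [ENNReal.tsum_mul_left, ENNReal.tsum_comm]
  apply le_of_eq
  congr 1
  have : ∀ k, ∑' j, (W s k * ‖v k‖ₑ ^ 2) * (W s (j - k) * ‖w (j - k)‖ₑ ^ 2) =
      (W s k * ‖v k‖ₑ ^ 2) * H s w := by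
    intro k
    rw [ENNReal.tsum_mul_left, tsum_sub_right k (fun j => W s j * ‖w j‖ₑ ^ 2)]
    rfl
  rw [tsum_congr this, ENNReal.tsum_mul_right]
  rfl

/-! ### Aliasing -/

instance {d K : ℕ} (j : Fin d → ℤ) : Decidable (inK d K j) := by unfold inK; infer_instance

def aliasEquiv (d K : ℕ) [NeZero K] : {j : Fin d → ℤ // inK d K j} × (Fin d → ℤ) ≃ (Fin d → ℤ) where
  toFun p := p.1.1 + (2 * (K : ℤ)) • p.2
  invFun l := (⟨fun i => (l i + K) % (2 * K) - K, by
    have hK : (0 : ℤ) < 2 * K := by have := NeZero.pos K; omega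
    intro i
    have h1 := Int.emod_nonneg (l i + K) hK.ne'
    have h2 := Int.emod_lt_of_pos (l i + K) hK
    dsimp only
    constructor <;> omega⟩, fun i => (l i + K) / (2 * K))
  left_inv := by
    rintro ⟨⟨j, hj⟩, m⟩
    have hK : (0 : ℤ) < 2 * K := by have := NeZero.pos K; omega
    have key : ∀ i, (j i + 2 * (K : ℤ) * m i + K) % (2 * K) = j i + K ∧
        (j i + 2 * (K : ℤ) * m i + K) / (2 * K) = m i := by
      intro i
      have h := hj i
      have e : j i + 2 * (K : ℤ) * m i + K = (j i + K) + 2 * K * m i := by ring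
      rw [e, Int.add_mul_emod_self_left, Int.add_mul_ediv_left _ _ hK.ne',
        Int.emod_eq_of_lt (by omega) (by omega), Int.ediv_eq_zero_of_lt (by omega) (by omega)]
      simp
    ext i
    · simp [(key i).1]
    · simp [(key i).2]
  right_inv := by
    intro l
    ext i
    have := Int.emod_add_mul_ediv (l i + K) (2 * K)
    simp
    linarith

lemma interp_apply_of {d K : ℕ} (v : Coef d) {j : Fin d → ℤ} (h : inK d K j) :
    interp d K v j = ∑' m : Fin d → ℤ, v (j + (2 * (K : ℤ)) • m) := by simp [interp, h]

lemma interp_apply_not {d K : ℕ} (v : Coef d) {j : Fin d → ℤ} (h : ¬ inK d K j) :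
    interp d K v j = 0 := by simp [interp, h]

lemma isTrig_interp (d K : ℕ) (v : Coef d) : isTrig d K (interp d K v) := fun _ h =>
  interp_apply_not v h

lemma tsum_alias {d K : ℕ} [NeZero K] (g : (Fin d → ℤ) → ℝ≥0∞) :
    ∑' j : {j : Fin d → ℤ // inK d K j}, ∑' m, g (j.1 + (2 * (K : ℤ)) • m) = ∑' l, g l := by
  rw [← ENNReal.tsum_prod (f := fun (j : {j : Fin d → ℤ // inK d K j}) m =>
    g (j.1 + (2 * (K : ℤ)) • m))]
  exact (aliasEquiv d K).tsum_eq g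

/-- a function vanishing outside 𝒦 -/
lemma tsum_inK {α : Type*} [AddCommMonoid α] [TopologicalSpace α] {d K : ℕ}
    (g : (Fin d → ℤ) → α) (hg : ∀ j, ¬ inK d K j → g j = 0) :
    ∑' j, g j = ∑' j : {j : Fin d → ℤ // inK d K j}, g j.1 := by
  symm
  apply tsum_subtype_eq_of_support_subset (s := {j | inK d K j})
  intro j hj
  by_contra h
  exact hj (hg j h)

lemma wt_alias {d K : ℕ} [NeZero K] (hd : 1 ≤ d) {j : Fin d → ℤ} (hj : inK d K j) (m : Fin d → ℤ) :
    wt j * wt m ≤ Real.sqrt d * wt (j + (2 * (K : ℤ)) • m) := by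
  have hK : (1 : ℤ) ≤ K := by have := NeZero.pos K; omega
  have hd1 : 1 ≤ Real.sqrt d := by
    rw [Real.one_le_sqrt]; exact_mod_cast hd
  have hKm : (K : ℝ) * absZ m ≤ absZ (j + (2 * (K : ℤ)) • m) := by
    rw [absZ, absZ]
    have hK0 : (0 : ℝ) ≤ K := by positivity
    rw [← Real.sqrt_sq hK0, ← Real.sqrt_mul (sq_nonneg _), Finset.mul_sum]
    apply Real.sqrt_le_sqrt
    apply Finset.sum_le_sum
    intro i _
    have h := hj i
    have : (K * m i) ^ 2 ≤ (j i + 2 * (K : ℤ) * m i) ^ 2 := by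
      rw [sq_le_sq]
      rcases lt_trichotomy (m i) 0 with h0 | h0 | h0
      · rw [abs_of_nonpos (by nlinarith), abs_of_nonpos (by nlinarith)]; nlinarith
      · simp [h0]
      · rw [abs_of_nonneg (by nlinarith), abs_of_nonneg (by nlinarith)]; nlinarith
    have h3 : ((K : ℝ) * m i) ^ 2 ≤ (j i + 2 * (K : ℝ) * m i) ^ 2 := by exact_mod_cast this
    simp only [Pi.add_apply, Pi.smul_apply, smul_eq_mul, Int.cast_add, Int.cast_mul,
      Int.cast_ofNat, Int.cast_natCast]
    linarith [mul_pow (K : ℝ) (m i : ℝ) 2]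
  have hjK : wt j ≤ Real.sqrt d * K := by
    have hK' : (1 : ℝ) ≤ K := by exact_mod_cast hK
    apply max_le _ (by nlinarith)
    rw [absZ]
    have : Real.sqrt d * K = Real.sqrt (d * (K : ℝ) ^ 2) := by
      rw [Real.sqrt_mul (by positivity), Real.sqrt_sq (by positivity)]
    rw [this]
    apply Real.sqrt_le_sqrt
    calc ∑ i, ((j i : ℝ)) ^ 2 ≤ ∑ i : Fin d, (K : ℝ) ^ 2 := by
          apply Finset.sum_le_sum
          intro i _
          have h := hj i
          have : (j i) ^ 2 ≤ (K : ℤ) ^ 2 := by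
            rw [sq_le_sq, abs_of_nonneg (by omega : (0 : ℤ) ≤ K), abs_le]
            omega
          exact_mod_cast this
      _ = _ := by simp
  by_cases hm : m = 0
  · subst hm
    have h1 : wt (0 : Fin d → ℤ) = 1 := by simp [wt, absZ]
    rw [h1]
    simp only [smul_zero, add_zero, mul_one]
    nlinarith [wt_pos j]
  · have hm1 : 1 ≤ absZ m := by
      rw [absZ, Real.one_le_sqrt]
      obtain ⟨i, hi⟩ := Function.ne_iff.1 hm
      have h1 : (1 : ℤ) ≤ (m i) ^ 2 := by
        have : 0 < (m i) ^ 2 := by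
          have h0 : m i ≠ 0 := by simpa using hi
          positivity
        omega
      have h2 : (1 : ℝ) ≤ (m i : ℝ) ^ 2 := by exact_mod_cast h1
      exact h2.trans (Finset.single_le_sum (f := fun i => ((m i : ℝ)) ^ 2)
        (fun i _ => sq_nonneg _) (Finset.mem_univ i))
    have h1 : wt m = absZ m := max_eq_left hm1
    rw [h1]
    calc wt j * absZ m ≤ (Real.sqrt d * K) * absZ m := by gcongr
      _ = Real.sqrt d * (K * absZ m) := by ring
      _ ≤ _ := by
        gcongr
        exact hKm.trans (le_max_left _ _)

def Binterp (d : ℕ) (s : ℝ) : ℝ≥0∞ := ENNReal.ofReal (Real.sqrt d ^ (2 * s)) * SW d s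

lemma W_alias {d K : ℕ} [NeZero K] (hd : 1 ≤ d) {s : ℝ} (hs : 0 ≤ s) {j : Fin d → ℤ}
    (hj : inK d K j) :
    W s j * ∑' m, (W s (j + (2 * (K : ℤ)) • m))⁻¹ ≤ Binterp d s := by
  rw [← ENNReal.tsum_mul_left, Binterp, SW, ← ENNReal.tsum_mul_left]
  apply ENNReal.tsum_le_tsum
  intro m
  rw [← div_eq_mul_inv, ENNReal.div_le_iff (W_ne_zero _ _) (W_ne_top _ _)]
  have h : W s j * W s m ≤ ENNReal.ofReal (Real.sqrt d ^ (2 * s)) * W s (j + (2 * (K : ℤ)) • m) := by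
    rw [W, W, W, ← ENNReal.ofReal_mul (Real.rpow_nonneg (wt_pos _).le _),
      ← ENNReal.ofReal_mul (by positivity), ← Real.mul_rpow (wt_pos _).le (wt_pos _).le,
      ← Real.mul_rpow (by positivity) (wt_pos _).le]
    apply ENNReal.ofReal_le_ofReal
    exact Real.rpow_le_rpow (mul_nonneg (wt_pos _).le (wt_pos _).le) (wt_alias hd hj m)
      (by linarith)
  calc W s j = W s j * W s m * (W s m)⁻¹ := by
        rw [mul_assoc, ENNReal.mul_inv_cancel (W_ne_zero s m) (W_ne_top s m), mul_one]
    _ ≤ ENNReal.ofReal (Real.sqrt d ^ (2 * s)) * W s (j + (2 * (K : ℤ)) • m) * (W s m)⁻¹ := by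
        gcongr
    _ = _ := by ring

lemma H_interp {d K : ℕ} [NeZero K] (hd : 1 ≤ d) {s : ℝ} (hs : 0 ≤ s) (x : Coef d) :
    H s (interp d K x) ≤ Binterp d s * H s x := by
  rw [H, tsum_inK (K := K) (fun j => W s j * ‖interp d K x j‖ₑ ^ 2)
    (fun j hj => by simp [interp_apply_not x hj])]
  rw [H, ← tsum_alias (K := K) (fun l => W s l * ‖x l‖ₑ ^ 2), ← ENNReal.tsum_mul_left]
  apply ENNReal.tsum_le_tsum
  rintro ⟨j, hj⟩
  simp only
  rw [interp_apply_of x hj]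
  have h := enorm_tsum_sq_le (fun m => x (j + (2 * (K : ℤ)) • m))
    (fun m => W s (j + (2 * (K : ℤ)) • m)) (fun m => W_ne_zero _ _) (fun m => W_ne_top _ _)
  calc _ ≤ W s j * ((∑' m, (W s (j + (2 * (K : ℤ)) • m))⁻¹) *
        ∑' m, W s (j + (2 * (K : ℤ)) • m) * ‖x (j + (2 * (K : ℤ)) • m)‖ₑ ^ 2) := by gcongr
    _ = (W s j * (∑' m, (W s (j + (2 * (K : ℤ)) • m))⁻¹)) *
        ∑' m, W s (j + (2 * (K : ℤ)) • m) * ‖x (j + (2 * (K : ℤ)) • m)‖ₑ ^ 2 := by ring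
    _ ≤ _ := by
      gcongr
      exact W_alias hd hs hj
end Part2

section Part3
open scoped ENNReal

/-- `ℓ¹` norm. -/
def L1 {d : ℕ} (v : Coef d) : ℝ≥0∞ := ∑' j, ‖v j‖ₑ

lemma summable_of_L1 {ι : Type*} {f : ι → ℂ} (h : ∑' i, ‖f i‖ₑ ≠ ⊤) : Summable fun i => ‖f i‖ := by
  have := ENNReal.summable_toReal h
  simpa using this

lemma L1_conv {d : ℕ} (v w : Coef d) : L1 (conv v w) ≤ L1 v * L1 w := by
  rw [L1]
  calc ∑' j, ‖conv v w j‖ₑ ≤ ∑' j, ∑' k, ‖v k‖ₑ * ‖w (j - k)‖ₑ := by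
        apply ENNReal.tsum_le_tsum
        intro j
        refine (enorm_tsum_le' _).trans (le_of_eq ?_)
        simp [enorm_mul]
    _ = ∑' k, ∑' j, ‖v k‖ₑ * ‖w (j - k)‖ₑ := ENNReal.tsum_comm
    _ = ∑' k, ‖v k‖ₑ * L1 w := by
        apply tsum_congr
        intro k
        rw [ENNReal.tsum_mul_left, tsum_sub_right k (fun j => ‖w j‖ₑ)]
        rfl
    _ = _ := by rw [ENNReal.tsum_mul_right]; rfl

lemma L1_convPow {d : ℕ} (v : Coef d) (n : ℕ) : L1 (convPow v n) ≤ L1 v ^ n := by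
  induction n with
  | zero =>
    rw [L1, tsum_eq_single 0]
    · simp [convPow]
    · intro j hj; simp [convPow, hj]
  | succ n ih =>
    rw [pow_succ']
    refine (L1_conv _ _).trans ?_
    gcongr

/-- general power series bound -/
lemma tsum_series_ne_top {d : ℕ} {v : Coef d} (hv : L1 v ≠ ⊤) (c : ℕ → ℂ)
    (hc : ∀ n, ‖c n‖ ≤ ((n.factorial : ℝ))⁻¹) :
    ∑' n, ∑' j, ‖c n * convPow v n j‖ₑ ≠ ⊤ := by
  have h1 : ∀ n, ∑' j, ‖c n * convPow v n j‖ₑ ≤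
      ENNReal.ofReal ((L1 v).toReal ^ n / n.factorial) := by
    intro n
    calc ∑' j, ‖c n * convPow v n j‖ₑ = ‖c n‖ₑ * L1 (convPow v n) := by
          rw [L1, ← ENNReal.tsum_mul_left]; simp [enorm_mul]
      _ ≤ ENNReal.ofReal ((n.factorial : ℝ))⁻¹ * L1 v ^ n := by
          gcongr
          · rw [← ofReal_norm]; exact ENNReal.ofReal_le_ofReal (hc n)
          · exact L1_convPow v n
      _ = _ := by
          rw [div_eq_inv_mul, ENNReal.ofReal_mul (by positivity),
            ENNReal.ofReal_pow ENNReal.toReal_nonneg, ENNReal.ofReal_toReal hv]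
  refine ne_top_of_le_ne_top ?_ (ENNReal.tsum_le_tsum h1)
  exact (Real.summable_pow_div_factorial _).tsum_ofReal_ne_top

lemma L1_series {d : ℕ} {v : Coef d} (hv : L1 v ≠ ⊤) (c : ℕ → ℂ)
    (hc : ∀ n, ‖c n‖ ≤ ((n.factorial : ℝ))⁻¹) :
    L1 (fun j => ∑' n, c n * convPow v n j) ≠ ⊤ := by
  refine ne_top_of_le_ne_top (tsum_series_ne_top hv c hc) ?_
  rw [ENNReal.tsum_comm]
  exact ENNReal.tsum_le_tsum fun j => enorm_tsum_le' _

/-! ### Grid evaluation -/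

def chi {d : ℕ} (K : ℕ) (k j : Fin d → ℤ) : ℂ :=
  Complex.exp (((Real.pi * ((∑ i, j i * k i : ℤ) : ℝ) / K : ℝ) : ℂ) * Complex.I)

lemma norm_chi {d : ℕ} (K : ℕ) (k j : Fin d → ℤ) : ‖chi K k j‖ = 1 :=
  Complex.norm_exp_ofReal_mul_I _

lemma chi_zero {d : ℕ} (K : ℕ) (k : Fin d → ℤ) : chi K k 0 = 1 := by simp [chi]

lemma chi_add {d : ℕ} (K : ℕ) (k j l : Fin d → ℤ) :
    chi K k (j + l) = chi K k j * chi K k l := by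
  rw [chi, chi, chi, ← Complex.exp_add]
  congr 1
  simp only [Pi.add_apply, add_mul, Finset.sum_add_distrib]
  push_cast
  ring

lemma chi_neg {d : ℕ} (K : ℕ) (k j : Fin d → ℤ) :
    chi K k (-j) = (starRingEnd ℂ) (chi K k j) := by
  rw [chi, chi, ← Complex.exp_conj]
  congr 1
  simp
  ring

lemma chi_alias {d : ℕ} (K : ℕ) [NeZero K] (k j m : Fin d → ℤ) :
    chi K k (j + (2 * (K : ℤ)) • m) = chi K k j := by
  rw [chi_add]
  have : chi K k ((2 * (K : ℤ)) • m) = 1 := by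
    rw [chi, Complex.exp_eq_one_iff]
    refine ⟨∑ i, m i * k i, ?_⟩
    have hK : (K : ℂ) ≠ 0 := by exact_mod_cast NeZero.ne K
    simp only [Pi.smul_apply, smul_eq_mul]
    have : ∑ i, 2 * (K : ℤ) * m i * k i = 2 * K * ∑ i, m i * k i := by
      rw [Finset.mul_sum]; apply Finset.sum_congr rfl; intros; ring
    rw [this]
    push_cast
    field_simp
  rw [this, mul_one]

def E {d : ℕ} (K : ℕ) (k : Fin d → ℤ) (v : Coef d) : ℂ := ∑' j, v j * chi K k j

lemma tsum_enorm_chi {d : ℕ} (K : ℕ) (k : Fin d → ℤ) (v : Coef d) :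
    ∑' j, ‖v j * chi K k j‖ₑ = L1 v := by
  rw [L1]
  apply tsum_congr
  intro j
  rw [enorm_mul, ← ofReal_norm (chi K k j), norm_chi]; simp

lemma summable_chi {d : ℕ} (K : ℕ) (k : Fin d → ℤ) {v : Coef d} (hv : L1 v ≠ ⊤) :
    Summable fun j => ‖v j * chi K k j‖ :=
  summable_of_L1 (by rwa [tsum_enorm_chi])

lemma E_add {d : ℕ} (K : ℕ) (k : Fin d → ℤ) {v w : Coef d} (hv : L1 v ≠ ⊤) (hw : L1 w ≠ ⊤) :
    E K k (v + w) = E K k v + E K k w := by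
  rw [E, E, E, ← (summable_chi K k hv).of_norm.tsum_add (summable_chi K k hw).of_norm]
  simp [add_mul]

lemma E_smul {d : ℕ} (K : ℕ) (k : Fin d → ℤ) (c : ℂ) (v : Coef d) :
    E K k (c • v) = c * E K k v := by
  rw [E, E, ← tsum_mul_left]
  simp [mul_assoc]

lemma E_conjC {d : ℕ} (K : ℕ) (k : Fin d → ℤ) (v : Coef d) :
    E K k (conjC v) = (starRingEnd ℂ) (E K k v) := by
  rw [E, E, Complex.conj_tsum, ← (Equiv.neg (Fin d → ℤ)).tsum_eq]
  apply tsum_congr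
  intro j
  simp [conjC, chi_neg]

lemma E_conv {d : ℕ} (K : ℕ) (k : Fin d → ℤ) {v w : Coef d} (hv : L1 v ≠ ⊤) (hw : L1 w ≠ ⊤) :
    E K k (conv v w) = E K k v * E K k w := by
  rw [E, E, E, tsum_mul_tsum_of_summable_norm (summable_chi K k hv) (summable_chi K k hw)]
  have hs := summable_mul_of_summable_norm (summable_chi K k hv) (summable_chi K k hw)
  let e : (Fin d → ℤ) × (Fin d → ℤ) ≃ (Fin d → ℤ) × (Fin d → ℤ) :=
    { toFun := fun p => (p.2, p.1 - p.2)
      invFun := fun p => (p.1 + p.2, p.1)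
      left_inv := by intro p; simp
      right_inv := by intro p; simp }
  rw [← e.tsum_eq]
  have hs' := (e.summable_iff).2 hs
  refine Eq.trans ?_ hs'.tsum_prod.symm
  apply tsum_congr
  intro j
  rw [conv, ← tsum_mul_right]
  apply tsum_congr
  intro l
  have : chi K k j = chi K k l * chi K k (j - l) := by rw [← chi_add]; simp
  simp only [e, Function.comp_apply, Equiv.coe_fn_mk, this]
  ring

lemma E_convPow {d : ℕ} (K : ℕ) (k : Fin d → ℤ) {v : Coef d} (hv : L1 v ≠ ⊤) (n : ℕ) :
    E K k (convPow v n) = E K k v ^ n := by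
  induction n with
  | zero =>
    rw [E, tsum_eq_single 0]
    · simp [convPow, chi_zero]
    · intro j hj; simp [convPow, hj]
  | succ n ih =>
    rw [pow_succ', ← ih, convPow, E_conv K k hv]
    exact ne_top_of_le_ne_top (ENNReal.pow_ne_top hv) (L1_convPow v n)

lemma E_series {d : ℕ} (K : ℕ) (k : Fin d → ℤ) {v : Coef d} (hv : L1 v ≠ ⊤) (c : ℕ → ℂ)
    (hc : ∀ n, ‖c n‖ ≤ ((n.factorial : ℝ))⁻¹) :
    E K k (fun j => ∑' n, c n * convPow v n j) = ∑' n, c n * E K k v ^ n := by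
  have h1 : ∑' p : ℕ × (Fin d → ℤ), ‖c p.1 * convPow v p.1 p.2 * chi K k p.2‖ₑ ≠ ⊤ := by
    rw [ENNReal.tsum_prod (f := fun n j => ‖c n * convPow v n j * chi K k j‖ₑ)]
    have : ∀ n, ∑' j, ‖c n * convPow v n j * chi K k j‖ₑ = ∑' j, ‖c n * convPow v n j‖ₑ :=
      fun n => tsum_enorm_chi K k (fun j => c n * convPow v n j)
    rw [tsum_congr this]
    exact tsum_series_ne_top hv c hc
  have h2 : Summable fun p : ℕ × (Fin d → ℤ) => c p.1 * convPow v p.1 p.2 * chi K k p.2 :=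
    (summable_of_L1 h1).of_norm
  have h3 := h2.tsum_comm (f := fun n j => c n * convPow v n j * chi K k j)
  rw [E]
  simp only [← tsum_mul_right]
  rw [h3]
  apply tsum_congr
  intro n
  rw [← E_convPow K k hv, E, ← tsum_mul_left]
  apply tsum_congr
  intro j
  ring

lemma fact_bound (n : ℕ) : ‖((n.factorial : ℂ))⁻¹‖ ≤ ((n.factorial : ℝ))⁻¹ := by simp

lemma fact_bound' (n : ℕ) : ‖(((n + 1).factorial : ℂ))⁻¹‖ ≤ ((n.factorial : ℝ))⁻¹ := by
  rw [norm_inv, Complex.norm_natCast]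
  apply inv_anti₀ (by positivity)
  exact_mod_cast Nat.factorial_le (Nat.le_succ n)

lemma L1_expC {d : ℕ} {v : Coef d} (hv : L1 v ≠ ⊤) : L1 (expC v) ≠ ⊤ :=
  L1_series hv _ fact_bound

lemma L1_phiC {d : ℕ} {v : Coef d} (hv : L1 v ≠ ⊤) : L1 (phiC v) ≠ ⊤ :=
  L1_series hv _ fact_bound'

lemma E_expC {d : ℕ} (K : ℕ) (k : Fin d → ℤ) {v : Coef d} (hv : L1 v ≠ ⊤) :
    E K k (expC v) = Complex.exp (E K k v) := by
  have := E_series K k hv _ fact_bound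
  refine Eq.trans this ?_
  rw [Complex.exp_eq_exp_ℂ, NormedSpace.exp_eq_tsum ℂ]
  simp

lemma E_phiC {d : ℕ} (K : ℕ) (k : Fin d → ℤ) {v : Coef d} (hv : L1 v ≠ ⊤) :
    E K k v * E K k (phiC v) = Complex.exp (E K k v) - 1 := by
  have h := E_series K k hv _ fact_bound'
  have h' : E K k (phiC v) = ∑' n : ℕ, (((n + 1).factorial : ℂ))⁻¹ * E K k v ^ n := h
  rw [h', Complex.exp_eq_exp_ℂ, NormedSpace.exp_eq_tsum_div]
  have hs := NormedSpace.expSeries_div_summable (E K k v)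
  simp only
  rw [hs.tsum_eq_zero_add, ← tsum_mul_left]
  simp only [pow_zero, Nat.factorial_zero, Nat.cast_one, div_one, add_sub_cancel_left]
  apply tsum_congr
  intro n
  rw [pow_succ]
  ring

lemma L1_interp {d K : ℕ} [NeZero K] (x : Coef d) : L1 (interp d K x) ≤ L1 x := by
  rw [L1, tsum_inK (K := K) (fun j => ‖interp d K x j‖ₑ)
    (fun j hj => by simp [interp_apply_not x hj])]
  rw [L1, ← tsum_alias (K := K) (fun l => ‖x l‖ₑ)]
  apply ENNReal.tsum_le_tsum
  rintro ⟨j, hj⟩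
  simp only
  rw [interp_apply_of x hj]
  exact enorm_tsum_le' _

lemma E_interp {d K : ℕ} [NeZero K] (k : Fin d → ℤ) {x : Coef d} (hx : L1 x ≠ ⊤) :
    E K k (interp d K x) = E K k x := by
  rw [E, E, tsum_inK (K := K) _ (fun j hj => by simp [interp_apply_not x hj])]
  have hs := (summable_chi K k hx).of_norm
  rw [← (aliasEquiv d K).tsum_eq]
  refine Eq.trans ?_ ((aliasEquiv d K).summable_iff.2 hs).tsum_prod.symm
  apply tsum_congr
  rintro ⟨j, hj⟩
  simp only
  rw [interp_apply_of x hj, ← tsum_mul_right]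
  apply tsum_congr
  intro m
  change _ = x (j + (2 * (K : ℤ)) • m) * chi K k (j + (2 * (K : ℤ)) • m)
  rw [chi_alias]

/-- the finite set 𝒦 -/
def KS (d K : ℕ) : Finset (Fin d → ℤ) := Fintype.piFinset fun _ => Finset.Ico (-(K : ℤ)) K

lemma mem_KS {d K : ℕ} {j : Fin d → ℤ} : j ∈ KS d K ↔ inK d K j := by
  simp [KS, inK, Fintype.mem_piFinset]

lemma L1_trig {d K : ℕ} {v : Coef d} (hv : isTrig d K v) : L1 v ≠ ⊤ := by
  rw [L1, tsum_eq_sum (s := KS d K)]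
  · simp
  · intro j hj
    rw [mem_KS] at hj
    simp [hv j hj]

lemma H_trig {d K : ℕ} (s : ℝ) {v : Coef d} (hv : isTrig d K v) : H s v ≠ ⊤ := by
  rw [H, tsum_eq_sum (s := KS d K)]
  · exact ENNReal.sum_ne_top.2 fun j _ => ENNReal.mul_ne_top (W_ne_top s j) (by simp)
  · intro j hj
    rw [mem_KS] at hj
    simp [hv j hj]

/-- characters in the grid variable -/
def chiHom {d : ℕ} (K : ℕ) (j : Fin d → ℤ) : Multiplicative (Fin d → ℤ) →* ℂ where
  toFun k := chi K k.toAdd j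
  map_one' := by simp [chi]
  map_mul' a b := by
    have h : ∀ a b : Fin d → ℤ, chi K a b = chi K b a := by
      intro a b; simp [chi, mul_comm]
    rw [h, h a.toAdd, h b.toAdd]
    exact chi_add K _ _ _

lemma chiHom_inj {d K : ℕ} [NeZero K] {j l : Fin d → ℤ} (hj : inK d K j) (hl : inK d K l)
    (h : chiHom K j = chiHom K l) : j = l := by
  ext i
  have h1 := DFunLike.congr_fun h (Multiplicative.ofAdd (Pi.single i (1 : ℤ)))
  simp only [chiHom, MonoidHom.coe_mk, OneHom.coe_mk, toAdd_ofAdd, chi] at h1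
  rw [Complex.exp_eq_exp_iff_exists_int] at h1
  obtain ⟨n, hn⟩ := h1
  have hK : (K : ℂ) ≠ 0 := by exact_mod_cast NeZero.ne K
  have hpi : (Real.pi : ℂ) ≠ 0 := by exact_mod_cast Real.pi_ne_zero
  simp [Pi.single_apply] at hn
  have h2 : (j i : ℂ) = l i + 2 * K * n := by
    field_simp at hn
    have h3 : (Real.pi : ℂ) * Complex.I * (j i : ℂ) =
        (Real.pi : ℂ) * Complex.I * (l i + 2 * K * n) := by linear_combination Complex.I * Real.pi * hn
    exact mul_left_cancel₀ (mul_ne_zero hpi Complex.I_ne_zero) h3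
  have h4 : j i = l i + 2 * K * n := by exact_mod_cast h2
  have h5 := hj i
  have h6 := hl i
  have hKp : (0 : ℤ) < K := by have := NeZero.pos K; omega
  have h7 : n = 0 := by
    by_contra hne
    rcases lt_or_gt_of_ne hne with h8 | h8
    · nlinarith
    · nlinarith
  rw [h4, h7]; simp

lemma E_trig {d K : ℕ} (k : Fin d → ℤ) {v : Coef d} (hv : isTrig d K v) :
    E K k v = ∑ j ∈ KS d K, v j * chi K k j := by
  rw [E, tsum_eq_sum]
  intro j hj
  rw [mem_KS] at hj
  simp [hv j hj]

lemma E_inj_zero {d K : ℕ} [NeZero K] {v : Coef d} (hv : isTrig d K v) (h : ∀ k, E K k v = 0) :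
    v = 0 := by
  have hli := linearIndependent_monoidHom (Multiplicative (Fin d → ℤ)) ℂ
  have hli2 := hli.comp (fun j : KS d K => chiHom K j.1) (by
    intro j l hjl
    exact Subtype.ext (chiHom_inj (mem_KS.1 j.2) (mem_KS.1 l.2) hjl))
  rw [Fintype.linearIndependent_iff] at hli2
  have h0 := hli2 (fun j => v j.1) (by
    ext k
    have := h k.toAdd
    rw [E_trig _ hv, ← Finset.sum_coe_sort] at this
    simpa [chiHom] using this)
  ext j
  by_cases hj : inK d K j
  · exact h0 ⟨j, mem_KS.2 hj⟩
  · exact hv j hj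
end Part3

section Part4
open scoped ENNReal

/-- Trigonometric polynomials as a submodule. -/
def trigSub (d K : ℕ) : Submodule ℂ (Coef d) where
  carrier := {v | isTrig d K v}
  add_mem' := by intro a b ha hb j hj; simp [ha j hj, hb j hj]
  zero_mem' := by intro j _; rfl
  smul_mem' := by intro c a ha j hj; simp [ha j hj]

/-- Interpolation constant. -/
def CI (d : ℕ) (s : ℝ) : ℝ := Real.sqrt (Binterp d s).toReal + 1
/-- Multiplication constant. -/
def CM (d : ℕ) (s : ℝ) : ℝ := Real.sqrt (Binterp d s * Aconv d s).toReal + 1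

lemma CI_pos (d : ℕ) (s : ℝ) : 0 < CI d s := by unfold CI; positivity
lemma CM_pos (d : ℕ) (s : ℝ) : 0 < CM d s := by unfold CM; positivity

lemma Binterp_ne_top {d : ℕ} {s : ℝ} (hs : (d : ℝ) / 2 < s) : Binterp d s ≠ ⊤ :=
  ENNReal.mul_ne_top ENNReal.ofReal_ne_top (SW_ne_top hs)
lemma Aconv_ne_top {d : ℕ} {s : ℝ} (hs : (d : ℝ) / 2 < s) : Aconv d s ≠ ⊤ :=
  ENNReal.mul_ne_top ENNReal.ofReal_ne_top (ENNReal.add_ne_top.2 ⟨SW_ne_top hs, SW_ne_top hs⟩)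

lemma le_sq_of_sqrt {a : ℝ≥0∞} (ha : a ≠ ⊤) :
    a ≤ ENNReal.ofReal ((Real.sqrt a.toReal + 1) ^ 2) := by
  rw [← ENNReal.ofReal_toReal ha]
  apply ENNReal.ofReal_le_ofReal
  rw [ENNReal.toReal_ofReal ENNReal.toReal_nonneg]
  have := Real.sq_sqrt (ENNReal.toReal_nonneg (a := a))
  nlinarith [Real.sqrt_nonneg a.toReal]

lemma sob_interp {d K : ℕ} [NeZero K] (hd : 1 ≤ d) {s : ℝ} (hs : (d : ℝ) / 2 < s) {x : Coef d}
    (hx : H s x ≠ ⊤) : sobNorm s (interp d K x) ≤ CI d s * sobNorm s x := by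
  have hs0 : 0 ≤ s := le_trans (by positivity) hs.le
  apply sobNorm_le_of_H (mul_nonneg (CI_pos d s).le (sobNorm_nonneg _ _))
  refine (H_interp hd hs0 x).trans ?_
  rw [mul_pow, ENNReal.ofReal_mul (by positivity), ← H_eq_of_ne_top hx]
  gcongr
  exact le_sq_of_sqrt (Binterp_ne_top hs)

lemma sob_interp_conv {d K : ℕ} [NeZero K] (hd : 1 ≤ d) {s : ℝ} (hs : (d : ℝ) / 2 < s)
    {v w : Coef d} (hv : H s v ≠ ⊤) (hw : H s w ≠ ⊤) :
    sobNorm s (interp d K (conv v w)) ≤ CM d s * (sobNorm s v * sobNorm s w) := by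
  have hs0 : 0 ≤ s := le_trans (by positivity) hs.le
  apply sobNorm_le_of_H (mul_nonneg (CM_pos d s).le
    (mul_nonneg (sobNorm_nonneg _ _) (sobNorm_nonneg _ _)))
  refine (H_interp hd hs0 _).trans ?_
  rw [mul_pow, mul_pow, ENNReal.ofReal_mul (by positivity), ENNReal.ofReal_mul (by positivity),
    ← H_eq_of_ne_top hv, ← H_eq_of_ne_top hw]
  calc _ ≤ Binterp d s * (Aconv d s * (H s v * H s w)) := by gcongr; exact H_conv hs0 v w
    _ = (Binterp d s * Aconv d s) * (H s v * H s w) := by ring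
    _ ≤ _ := by
      gcongr
      exact le_sq_of_sqrt (ENNReal.mul_ne_top (Binterp_ne_top hs) (Aconv_ne_top hs))

/-- Parameters. -/
class Par (d K : ℕ) (s : ℝ) : Prop where
  hd : 1 ≤ d
  hK : K ≠ 0
  hs : (d : ℝ) / 2 < s

/-- The algebra of trigonometric polynomials of degree `K` with collocation product. -/
def TA (d K : ℕ) (s : ℝ) : Type := let _ := s; trigSub d K

instance (d K : ℕ) (s : ℝ) : AddCommGroup (TA d K s) := inferInstanceAs (AddCommGroup (trigSub d K))
instance (d K : ℕ) (s : ℝ) : Module ℂ (TA d K s) := inferInstanceAs (Module ℂ (trigSub d K))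

variable {d K : ℕ} {s : ℝ}

def TA.val (a : TA d K s) : Coef d := Subtype.val (p := fun v => v ∈ trigSub d K) a
def TA.mk (v : Coef d) (hv : isTrig d K v) : TA d K s := (⟨v, hv⟩ : trigSub d K)

lemma TA.trig (a : TA d K s) : isTrig d K a.val := Subtype.property (p := fun v => v ∈ trigSub d K) a
lemma TA.ext' {a b : TA d K s} (h : a.val = b.val) : a = b := Subtype.ext h
@[simp] lemma TA.val_mk (v : Coef d) (hv : isTrig d K v) : (TA.mk v hv : TA d K s).val = v := rfl
@[simp] lemma TA.val_add (a b : TA d K s) : (a + b).val = a.val + b.val := rfl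
@[simp] lemma TA.val_sub (a b : TA d K s) : (a - b).val = a.val - b.val := rfl
@[simp] lemma TA.val_zero : (0 : TA d K s).val = 0 := rfl
@[simp] lemma TA.val_smul (c : ℂ) (a : TA d K s) : (c • a).val = c • a.val := rfl

/-- Interpolation as a map into the algebra. -/
def Q (x : Coef d) : TA d K s := TA.mk (interp d K x) (isTrig_interp d K x)

def EV (k : Fin d → ℤ) (a : TA d K s) : ℂ := E K k a.val

lemma TA.L1 (a : TA d K s) : Zak.L1 a.val ≠ ⊤ := L1_trig a.trig
lemma TA.H (a : TA d K s) : Zak.H s a.val ≠ ⊤ := H_trig s a.trig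

lemma EV_add (k : Fin d → ℤ) (a b : TA d K s) : EV k (a + b) = EV k a + EV k b :=
  E_add K k a.L1 b.L1
lemma EV_smul (k : Fin d → ℤ) (c : ℂ) (a : TA d K s) : EV k (c • a) = c * EV k a :=
  E_smul K k c a.val

lemma EV_ext [P : Par d K s] {a b : TA d K s} (h : ∀ k, EV k a = EV k b) : a = b := by
  have hK : NeZero K := ⟨P.hK⟩
  have h0 : (a + (-1 : ℂ) • b).val = 0 := by
    apply E_inj_zero (K := K) (a + (-1 : ℂ) • b).trig
    intro k
    have := EV_add k a ((-1 : ℂ) • b)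
    rw [EV_smul, h k] at this
    rw [← EV, this]; ring
  have h1 : a + (-1 : ℂ) • b = 0 := TA.ext' h0
  rw [neg_one_smul, ← sub_eq_add_neg] at h1
  exact sub_eq_zero.1 h1

lemma EV_Q [P : Par d K s] (k : Fin d → ℤ) {x : Coef d} (hx : L1 x ≠ ⊤) :
    EV k (Q x : TA d K s) = E K k x := by
  have hK : NeZero K := ⟨P.hK⟩
  exact E_interp k hx

def delta (d : ℕ) : Coef d := fun j => if j = 0 then 1 else 0

lemma L1_delta : L1 (delta d) ≠ ⊤ := by
  have := L1_convPow (0 : Coef d) 0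
  refine ne_top_of_le_ne_top ?_ this
  simp

lemma E_delta (k : Fin d → ℤ) : E K k (delta d) = 1 := by
  have h0 : L1 (0 : Coef d) ≠ ⊤ := by simp [L1]
  have := E_convPow K k h0 0
  rw [pow_zero] at this
  exact this

instance : Mul (TA d K s) := ⟨fun a b => Q (conv a.val b.val)⟩
instance : One (TA d K s) := ⟨Q (delta d)⟩

lemma L1_conv_ne {v w : Coef d} (hv : L1 v ≠ ⊤) (hw : L1 w ≠ ⊤) : L1 (conv v w) ≠ ⊤ :=
  ne_top_of_le_ne_top (ENNReal.mul_ne_top hv hw) (L1_conv v w)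

lemma EV_mul [P : Par d K s] (k : Fin d → ℤ) (a b : TA d K s) : EV k (a * b) = EV k a * EV k b := by
  have : a * b = Q (conv a.val b.val) := rfl
  rw [this, EV_Q k (L1_conv_ne a.L1 b.L1), E_conv K k a.L1 b.L1]; rfl

lemma EV_one [P : Par d K s] (k : Fin d → ℤ) : EV k (1 : TA d K s) = 1 := by
  have : (1 : TA d K s) = Q (delta d) := rfl
  rw [this, EV_Q k L1_delta, E_delta]

lemma EV_zero (k : Fin d → ℤ) : EV k (0 : TA d K s) = 0 := by
  simp [EV, E]

instance [P : Par d K s] : CommRing (TA d K s) :=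
  { (inferInstance : AddCommGroup (TA d K s)), (inferInstance : Mul (TA d K s)),
    (inferInstance : One (TA d K s)) with
    mul_assoc := fun a b c => EV_ext fun k => by simp only [EV_mul]; ring
    one_mul := fun a => EV_ext fun k => by simp only [EV_mul, EV_one, one_mul]
    mul_one := fun a => EV_ext fun k => by simp only [EV_mul, EV_one, mul_one]
    zero_mul := fun a => EV_ext fun k => by simp only [EV_mul, EV_zero, zero_mul]
    mul_zero := fun a => EV_ext fun k => by simp only [EV_mul, EV_zero, mul_zero]
    left_distrib := fun a b c => EV_ext fun k => by simp only [EV_mul, EV_add]; ring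
    right_distrib := fun a b c => EV_ext fun k => by simp only [EV_mul, EV_add]; ring
    mul_comm := fun a b => EV_ext fun k => by simp only [EV_mul]; ring }

/-- Isometric embedding into a Euclidean space. -/
def emb : TA d K s →ₗ[ℂ] EuclideanSpace ℂ (KS d K) where
  toFun a := WithLp.toLp 2 fun j => ((CM d s * wt j.1 ^ s : ℝ) : ℂ) * a.val j.1
  map_add' a b := by ext j; simp [mul_add]
  map_smul' c a := by ext j; simp; ring

lemma emb_inj : Function.Injective (emb : TA d K s →ₗ[ℂ] EuclideanSpace ℂ (KS d K)) := by
  rw [← LinearMap.ker_eq_bot, LinearMap.ker_eq_bot']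
  intro a h
  apply TA.ext'
  ext j
  by_cases hj : inK d K j
  · have h1 := congrArg (fun x : EuclideanSpace ℂ (KS d K) => x ⟨j, mem_KS.2 hj⟩) h
    simp only [emb, LinearMap.coe_mk, AddHom.coe_mk, PiLp.zero_apply] at h1
    rcases mul_eq_zero.1 h1 with h2 | h2
    · exfalso
      have : (0 : ℝ) < CM d s * wt j ^ s := mul_pos (CM_pos d s) (Real.rpow_pos_of_pos (wt_pos j) s)
      exact this.ne' (by exact_mod_cast h2)
    · exact h2
  · exact a.trig j hj

lemma norm_emb (a : TA d K s) : ‖emb a‖ = CM d s * sobNorm s a.val := by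
  rw [EuclideanSpace.norm_eq, sobNorm, tsum_eq_sum (s := KS d K)]
  · have : CM d s = Real.sqrt (CM d s ^ 2) := (Real.sqrt_sq (CM_pos d s).le).symm
    rw [this, ← Real.sqrt_mul (sq_nonneg _), Finset.mul_sum]
    congr 1
    rw [← Finset.sum_coe_sort (KS d K)
      (fun i => CM d s ^ 2 * (max (absZ i) 1 ^ (2 * s) * ‖a.val i‖ ^ 2))]
    apply Finset.sum_congr rfl
    intro j _
    simp only [emb, LinearMap.coe_mk, AddHom.coe_mk, norm_mul, Complex.norm_real, norm_pow,
      Real.norm_eq_abs, abs_of_pos (CM_pos d s)]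
    have hw := Real.rpow_pos_of_pos (wt_pos j.1) s
    rw [abs_of_pos hw, mul_pow, mul_pow, mul_assoc]
    congr 2
    change _ = wt j.1 ^ (2 * s)
    rw [mul_comm 2 s, Real.rpow_mul (wt_pos _).le]
    norm_cast
  · intro j hj
    rw [mem_KS] at hj
    simp [a.trig j hj]

instance : NormedAddCommGroup (TA d K s) :=
  NormedAddCommGroup.induced (TA d K s) (EuclideanSpace ℂ (KS d K)) emb emb_inj

lemma TA.norm_def (a : TA d K s) : ‖a‖ = CM d s * sobNorm s a.val := norm_emb a

instance : NormedSpace ℂ (TA d K s) :=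
  NormedSpace.induced ℂ (TA d K s) (EuclideanSpace ℂ (KS d K)) emb

lemma TA.norm_mul_le [P : Par d K s] (a b : TA d K s) : ‖a * b‖ ≤ ‖a‖ * ‖b‖ := by
  rw [TA.norm_def, TA.norm_def, TA.norm_def]
  have hK : NeZero K := ⟨P.hK⟩
  have h : sobNorm s (a * b).val ≤ CM d s * (sobNorm s a.val * sobNorm s b.val) :=
    sob_interp_conv P.hd P.hs a.H b.H
  have := mul_le_mul_of_nonneg_left h (CM_pos d s).le
  linarith

instance [P : Par d K s] : NormedCommRing (TA d K s) :=
  { (inferInstance : NormedAddCommGroup (TA d K s)), (inferInstance : CommRing (TA d K s)) with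
    norm_mul_le := TA.norm_mul_le }

instance [P : Par d K s] : Algebra ℂ (TA d K s) :=
  Algebra.ofModule (fun r x y => EV_ext fun k => by simp only [EV_mul, EV_smul]; ring)
    (fun r x y => EV_ext fun k => by simp only [EV_mul, EV_smul]; ring)

instance [P : Par d K s] : NormedAlgebra ℂ (TA d K s) :=
  { (inferInstance : Algebra ℂ (TA d K s)) with
    norm_smul_le := fun r x => norm_smul_le r x }

instance [P : Par d K s] : NormedAlgebra ℚ (TA d K s) := NormedAlgebra.restrictScalars ℚ ℂ _

instance : FiniteDimensional ℂ (TA d K s) := FiniteDimensional.of_injective emb emb_inj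

instance : CompleteSpace (TA d K s) := FiniteDimensional.complete ℂ _

/-- evaluation as ring hom -/
def EVh [P : Par d K s] (k : Fin d → ℤ) : TA d K s →ₐ[ℂ] ℂ :=
  AlgHom.ofLinearMap { toFun := EV k, map_add' := EV_add k, map_smul' := EV_smul k }
    (EV_one k) (EV_mul k)

lemma EV_exp [P : Par d K s] (k : Fin d → ℤ) (a : TA d K s) :
    EV k (NormedSpace.exp a) = Complex.exp (EV k a) := by
  have hc : Continuous (EVh k : TA d K s →ₐ[ℂ] ℂ) :=
    LinearMap.continuous_of_finiteDimensional (EVh k : TA d K s →ₐ[ℂ] ℂ).toLinearMap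
  have := NormedSpace.map_exp (EVh k : TA d K s →ₐ[ℂ] ℂ) hc a
  rw [Complex.exp_eq_exp_ℂ]
  exact this
end Part4

section Part5
section Abs
variable {A : Type*} [NormedCommRing A] [NormedAlgebra ℂ A] [NormedAlgebra ℚ A] [CompleteSpace A]

open NormedSpace in
lemma norm_exp_sub_one_le (a : A) : ‖exp a - 1‖ ≤ ‖a‖ * Real.exp ‖a‖ := by
  have h := exp_series_hasSum_exp' (𝕂 := ℂ) a
  have h1 := (hasSum_nat_add_iff' 1).2 h
  simp only [Finset.range_one, Finset.sum_singleton, Nat.factorial_zero, Nat.cast_one, inv_one,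
    pow_zero, one_smul] at h1
  have hr := expSeries_div_hasSum_exp (𝔸 := ℝ) ‖a‖
  rw [← Real.exp_eq_exp_ℝ] at hr
  have hr2 := hr.mul_left ‖a‖
  rw [← h1.tsum_eq]
  apply tsum_of_norm_bounded hr2
  intro n
  rw [norm_smul, norm_inv, Complex.norm_natCast]
  calc _ ≤ (((n + 1).factorial : ℝ))⁻¹ * ‖a‖ ^ (n + 1) := by
        gcongr; exact norm_pow_le' a (Nat.succ_pos n)
    _ ≤ ((n.factorial : ℝ))⁻¹ * ‖a‖ ^ (n + 1) := by
        gcongr; omega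
    _ = _ := by rw [pow_succ]; ring

open NormedSpace in
lemma norm_exp_mul_le (a x : A) : ‖exp a * x‖ ≤ (1 + ‖a‖ * Real.exp ‖a‖) * ‖x‖ := by
  have : exp a * x = x + (exp a - 1) * x := by ring
  rw [this]
  calc _ ≤ ‖x‖ + ‖exp a - 1‖ * ‖x‖ := (norm_add_le _ _).trans (by gcongr; exact norm_mul_le _ _)
    _ ≤ ‖x‖ + (‖a‖ * Real.exp ‖a‖) * ‖x‖ := by gcongr; exact norm_exp_sub_one_le a
    _ = _ := by ring

open NormedSpace in
lemma norm_exp_sub_exp_mul_le (a b x : A) :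
    ‖(exp a - exp b) * x‖ ≤
      (1 + ‖b‖ * Real.exp ‖b‖) * (‖a - b‖ * Real.exp ‖a - b‖ * ‖x‖) := by
  have h : exp a = exp b * exp (a - b) := by
    rw [← exp_add]; congr 1; abel
  have : (exp a - exp b) * x = exp b * ((exp (a - b) - 1) * x) := by rw [h]; ring
  rw [this]
  refine (norm_exp_mul_le _ _).trans ?_
  gcongr
  refine (norm_mul_le _ _).trans ?_
  gcongr
  exact norm_exp_sub_one_le _

open NormedSpace in
/-- One step in the abstract algebra. -/
def stepA (τ : ℝ) (v w φ p : A) : A :=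
  exp ((-Complex.I * (τ : ℂ)) • v) *
    (φ + (τ : ℂ)⁻¹ • ((exp ((-Complex.I * (τ : ℂ) ^ 2) • w) - 1) * p))

open NormedSpace in
/-- Lipschitz bound for the step. -/
lemma stepA_lip (B T : ℝ) (hB : 0 ≤ B) (hT : 0 ≤ T) : ∃ C, 0 ≤ C ∧ ∀ (A : Type)
    [NormedCommRing A] [NormedAlgebra ℂ A] [NormedAlgebra ℚ A] [CompleteSpace A]
    (τ : ℝ), 0 < τ → τ ≤ T → ∀ (e : ℝ) (v w φ p v' w' φ' p' : A),
    ‖v‖ ≤ B → ‖w‖ ≤ B → ‖φ‖ ≤ B → ‖p‖ ≤ B → ‖v'‖ ≤ B → ‖w'‖ ≤ B → ‖φ'‖ ≤ B → ‖p'‖ ≤ B →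
    ‖v - v'‖ ≤ e → ‖w - w'‖ ≤ e → ‖φ - φ'‖ ≤ e → ‖p - p'‖ ≤ e →
    ‖stepA τ v w φ p - stepA τ v' w' φ' p'‖ ≤ ‖φ - φ'‖ + C * τ * e := by
  -- X = sup of the exponentials
  obtain ⟨X, hX⟩ : ∃ X, X = Real.exp ((T + T ^ 2) * (2 * B)) := ⟨_, rfl⟩
  obtain ⟨Y, hY⟩ : ∃ Y, Y = 1 + (T + T ^ 2) * (2 * B) * X := ⟨_, rfl⟩
  have hX0 : 0 ≤ X := by rw [hX]; positivity
  have hY0 : 0 ≤ Y := by rw [hY]; positivity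
  refine ⟨B * X + Y * (X * (B + T * (B * X * B))) + Y * (B * X + Y * (X * B)), by positivity, ?_⟩
  intro A _ _ _ _ τ hτ hτT e v w φ p v' w' φ' p' hv hw hφ hp hv' hw' hφ' hp' ev ew eφ ep
  have he : 0 ≤ e := (norm_nonneg _).trans ev
  have hnv : ∀ x : A, ‖(-Complex.I * (τ : ℂ)) • x‖ = τ * ‖x‖ := by
    intro x; rw [norm_smul]; simp [abs_of_pos hτ]
  have hnw : ∀ x : A, ‖(-Complex.I * (τ : ℂ) ^ 2) • x‖ = τ ^ 2 * ‖x‖ := by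
    intro x; rw [norm_smul]; simp
  have hni : ∀ x : A, ‖(τ : ℂ)⁻¹ • x‖ = τ⁻¹ * ‖x‖ := by
    intro x; rw [norm_smul]; simp [abs_of_pos hτ]
  have hτ2 : τ ^ 2 ≤ T ^ 2 := by gcongr
  have hexp1 : ∀ x : A, ‖x‖ ≤ 2 * B → Real.exp (τ * ‖x‖) ≤ X := by
    intro x hx
    rw [hX]
    apply Real.exp_le_exp.2
    have : τ ≤ T + T ^ 2 := by nlinarith
    gcongr
  have hexp2 : ∀ x : A, ‖x‖ ≤ 2 * B → Real.exp (τ ^ 2 * ‖x‖) ≤ X := by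
    intro x hx
    rw [hX]
    apply Real.exp_le_exp.2
    have : τ ^ 2 ≤ T + T ^ 2 := by nlinarith
    gcongr
  have hYv : ∀ x : A, ‖x‖ ≤ 2 * B → 1 + (τ * ‖x‖) * Real.exp (τ * ‖x‖) ≤ Y := by
    intro x hx
    rw [hY]
    have := hexp1 x hx
    have : τ ≤ T + T ^ 2 := by nlinarith
    gcongr
  have hYw : ∀ x : A, ‖x‖ ≤ 2 * B → 1 + (τ ^ 2 * ‖x‖) * Real.exp (τ ^ 2 * ‖x‖) ≤ Y := by
    intro x hx
    rw [hY]
    have := hexp2 x hx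
    have : τ ^ 2 ≤ T + T ^ 2 := by nlinarith
    gcongr
  have h2 : ∀ {x : A}, ‖x‖ ≤ B → ‖x‖ ≤ 2 * B := fun h => by linarith
  have hsub : ∀ {x y : A}, ‖x‖ ≤ B → ‖y‖ ≤ B → ‖x - y‖ ≤ 2 * B := fun h h' =>
    (norm_sub_le _ _).trans (by linarith)
  set a := (-Complex.I * (τ : ℂ)) • v
  set a' := (-Complex.I * (τ : ℂ)) • v'
  set b := (-Complex.I * (τ : ℂ) ^ 2) • w
  set b' := (-Complex.I * (τ : ℂ) ^ 2) • w'
  have hav : a - a' = (-Complex.I * (τ : ℂ)) • (v - v') := (smul_sub _ _ _).symm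
  have hbw : b - b' = (-Complex.I * (τ : ℂ) ^ 2) • (w - w') := (smul_sub _ _ _).symm
  -- decomposition
  have hdec : stepA τ v w φ p - stepA τ v' w' φ' p' =
      (φ - φ') + (exp a - 1) * (φ - φ')
      + (exp a - exp a') * (φ' + (τ : ℂ)⁻¹ • ((exp b' - 1) * p'))
      + exp a * ((τ : ℂ)⁻¹ • ((exp b - 1) * (p - p') + (exp b - exp b') * p')) := by
    simp only [stepA]
    simp only [smul_add, mul_add, sub_mul, mul_sub, smul_sub, one_mul]
    ring
  rw [hdec]
  have hb1 : ∀ {x z : A}, ‖x‖ ≤ B → ‖(exp ((-Complex.I * (τ : ℂ) ^ 2) • x) - 1) * z‖ ≤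
      τ ^ 2 * (B * X * ‖z‖) := by
    intro x z hx
    refine (norm_mul_le _ _).trans ?_
    calc _ ≤ (τ ^ 2 * ‖x‖) * Real.exp (τ ^ 2 * ‖x‖) * ‖z‖ := by
          gcongr
          have := norm_exp_sub_one_le ((-Complex.I * (τ : ℂ) ^ 2) • x)
          rwa [hnw] at this
      _ ≤ (τ ^ 2 * B) * X * ‖z‖ := by
          have := hexp2 x (h2 hx)
          gcongr
      _ = _ := by ring
  -- term 2
  have t2 : ‖(exp a - 1) * (φ - φ')‖ ≤ τ * (B * X * e) := by
    refine (norm_mul_le _ _).trans ?_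
    calc _ ≤ (τ * ‖v‖) * Real.exp (τ * ‖v‖) * ‖φ - φ'‖ := by
          gcongr
          have := norm_exp_sub_one_le a
          rwa [hnv] at this
      _ ≤ (τ * B) * X * e := by
          have := hexp1 v (h2 hv)
          gcongr
      _ = _ := by ring
  -- term 3
  have t3 : ‖(exp a - exp a') * (φ' + (τ : ℂ)⁻¹ • ((exp b' - 1) * p'))‖ ≤
      τ * (Y * (X * (B + T * (B * X * B))) * e) := by
    have hz : ‖φ' + (τ : ℂ)⁻¹ • ((exp b' - 1) * p')‖ ≤ B + T * (B * X * B) := by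
      refine (norm_add_le _ _).trans ?_
      rw [hni]
      have h3 := hb1 (z := p') hw'
      have h4 : τ⁻¹ * ‖(exp b' - 1) * p'‖ ≤ τ⁻¹ * (τ ^ 2 * (B * X * ‖p'‖)) := by gcongr
      have h5 : τ⁻¹ * (τ ^ 2 * (B * X * ‖p'‖)) = τ * (B * X * ‖p'‖) := by field_simp
      have h6 : τ * (B * X * ‖p'‖) ≤ T * (B * X * B) := by gcongr
      linarith
    have h := norm_exp_sub_exp_mul_le a a' (φ' + (τ : ℂ)⁻¹ • ((exp b' - 1) * p'))
    rw [hav, hnv, hnv] at h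
    refine h.trans ?_
    calc _ ≤ Y * (τ * e * X * (B + T * (B * X * B))) := by
          have i1 := hYv v' (h2 hv')
          have i2 := hexp1 (v - v') (hsub hv hv')
          gcongr
      _ = _ := by ring
  -- term 4
  have t4 : ‖exp a * ((τ : ℂ)⁻¹ • ((exp b - 1) * (p - p') + (exp b - exp b') * p'))‖ ≤
      τ * (Y * (B * X + Y * (X * B)) * e) := by
    refine (norm_exp_mul_le _ _).trans ?_
    rw [hnv, hni]
    have i1 := hYv v (h2 hv)
    have h3 : ‖(exp b - 1) * (p - p') + (exp b - exp b') * p'‖ ≤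
        τ ^ 2 * ((B * X + Y * (X * B)) * e) := by
      refine (norm_add_le _ _).trans ?_
      have h4 := hb1 (z := p - p') hw
      have h5 : τ ^ 2 * (B * X * ‖p - p'‖) ≤ τ ^ 2 * (B * X * e) := by gcongr
      have h := norm_exp_sub_exp_mul_le b b' p'
      rw [hbw, hnw, hnw] at h
      have h6 : (1 + (τ ^ 2 * ‖w'‖) * Real.exp (τ ^ 2 * ‖w'‖)) * (τ ^ 2 * ‖w - w'‖ *
          Real.exp (τ ^ 2 * ‖w - w'‖) * ‖p'‖) ≤ Y * (τ ^ 2 * e * X * B) := by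
        have i1 := hYw w' (h2 hw')
        have i2 := hexp2 (w - w') (hsub hw hw')
        gcongr
      linarith
    calc _ ≤ Y * (τ⁻¹ * (τ ^ 2 * ((B * X + Y * (X * B)) * e))) := by gcongr
      _ = _ := by field_simp
  refine (norm_add_le _ _).trans ?_
  refine (add_le_add_left (norm_add_le _ _) _).trans ?_
  refine (add_le_add_left (add_le_add_left (norm_add_le _ _) _) _).trans ?_
  linarith

end Abs
end Part5

section Part6
section Link
open scoped ENNReal
variable {d K : ℕ} {s : ℝ}

lemma L1_add_ne {v w : Coef d} (hv : L1 v ≠ ⊤) (hw : L1 w ≠ ⊤) : L1 (v + w) ≠ ⊤ := by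
  refine ne_top_of_le_ne_top (ENNReal.add_ne_top.2 ⟨hv, hw⟩) ?_
  rw [L1, L1, L1, ← ENNReal.tsum_add]
  exact ENNReal.tsum_le_tsum fun j => enorm_add_le _ _

lemma L1_smul_ne (c : ℂ) {v : Coef d} (hv : L1 v ≠ ⊤) : L1 (c • v) ≠ ⊤ := by
  have : L1 (c • v) = ‖c‖ₑ * L1 v := by
    rw [L1, L1, ← ENNReal.tsum_mul_left]
    exact tsum_congr fun j => by simp [enorm_mul]
  rw [this]
  exact ENNReal.mul_ne_top (by simp) hv

lemma L1_conjC (v : Coef d) : L1 (conjC v) = L1 v := by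
  rw [L1, L1, ← (Equiv.neg (Fin d → ℤ)).tsum_eq]
  exact tsum_congr fun j => by simp [conjC]

lemma H_conjC (v : Coef d) : H s (conjC v) = H s v := by
  rw [H, H, ← (Equiv.neg (Fin d → ℤ)).tsum_eq]
  exact tsum_congr fun j => by simp [conjC, W_neg]

lemma reC_eq (v : Coef d) : reC v = (1 / 2 : ℂ) • (v + conjC v) := by
  ext j; simp [reC, conjC]; ring

lemma sobNorm_conjC (v : Coef d) : sobNorm s (conjC v) = sobNorm s v := by
  rw [sobNorm_eq, sobNorm_eq, H_conjC]

/-- Complex conjugation in the algebra. -/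
def bar (a : TA d K s) : TA d K s := Q (conjC a.val)

lemma EV_bar [P : Par d K s] (k : Fin d → ℤ) (a : TA d K s) :
    EV k (bar a) = (starRingEnd ℂ) (EV k a) := by
  rw [bar, EV_Q k (by rw [L1_conjC]; exact a.L1), E_conjC]; rfl

lemma EV_sub [P : Par d K s] (k : Fin d → ℤ) (a b : TA d K s) : EV k (a - b) = EV k a - EV k b :=
  map_sub (EVh k : TA d K s →ₐ[ℂ] ℂ) a b

lemma bar_add [P : Par d K s] (a b : TA d K s) : bar (a + b) = bar a + bar b :=
  EV_ext fun k => by simp [EV_bar, EV_add]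

lemma bar_sub [P : Par d K s] (a b : TA d K s) : bar (a - b) = bar a - bar b :=
  EV_ext fun k => by simp [EV_bar, EV_sub]

lemma norm_bar_le [P : Par d K s] (a : TA d K s) : ‖bar a‖ ≤ CI d s * ‖a‖ := by
  have hK : NeZero K := ⟨P.hK⟩
  rw [TA.norm_def, TA.norm_def]
  have h : sobNorm s (bar a).val ≤ CI d s * sobNorm s (conjC a.val) :=
    sob_interp P.hd P.hs (by rw [H_conjC]; exact a.H)
  rw [sobNorm_conjC] at h
  have := mul_le_mul_of_nonneg_left h (CM_pos d s).le
  linarith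

lemma Q_absSq [P : Par d K s] (a : TA d K s) : Q (absSq a.val) = a * bar a :=
  EV_ext fun k => by
    have h : L1 (conjC a.val) ≠ ⊤ := by rw [L1_conjC]; exact a.L1
    rw [absSq, EV_Q k (L1_conv_ne a.L1 h), EV_mul, EV_bar, E_conv K k a.L1 h, E_conjC]; rfl

lemma Q_reC [P : Par d K s] (p φ : TA d K s) : Q (reC (conv p.val (conjC φ.val))) =
    (1 / 2 : ℂ) • (p * bar φ + bar p * φ) :=
  EV_ext fun k => by
    have h : L1 (conjC φ.val) ≠ ⊤ := by rw [L1_conjC]; exact φ.L1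
    have h2 := L1_conv_ne p.L1 h
    have h3 : L1 (conjC (conv p.val (conjC φ.val))) ≠ ⊤ := by rwa [L1_conjC]
    rw [reC_eq, EV_Q k (L1_smul_ne _ (L1_add_ne h2 h3)), E_smul, E_add K k h2 h3, E_conjC,
      E_conv K k p.L1 h, E_conjC, EV_smul, EV_add, EV_mul, EV_mul, EV_bar, EV_bar]
    simp [EV]

/-- Fourier multiplier on the algebra. -/
def mulT (g : ℝ → ℂ) : TA d K s →ₗ[ℂ] TA d K s where
  toFun a := TA.mk (mulOp g a.val) (fun j hj => by simp [mulOp, a.trig j hj])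
  map_add' a b := TA.ext' (funext fun j => mul_add _ _ _)
  map_smul' c a := TA.ext' (funext fun j => mul_left_comm _ _ _)

lemma mulT_val (g : ℝ → ℂ) (a : TA d K s) : (mulT g a).val = mulOp g a.val := rfl

lemma norm_mulT_le {g : ℝ → ℂ} {c : ℝ} (hc : 0 ≤ c) (hg : ∀ x, ‖g x‖ ≤ c) (a : TA d K s) :
    ‖mulT g a‖ ≤ c * ‖a‖ := by
  rw [TA.norm_def, TA.norm_def, mulT_val]
  have h : sobNorm s (mulOp g a.val) ≤ c * sobNorm s a.val := by
    apply sobNorm_le_of_H (mul_nonneg hc (sobNorm_nonneg _ _))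
    rw [mul_pow, ENNReal.ofReal_mul (by positivity), ← H_eq_of_ne_top a.H, H, H,
      ← ENNReal.tsum_mul_left]
    apply ENNReal.tsum_le_tsum
    intro j
    have : ‖mulOp g a.val j‖ₑ ^ 2 ≤ ENNReal.ofReal (c ^ 2) * ‖a.val j‖ₑ ^ 2 := by
      rw [mulOp, enorm_mul, mul_pow, ENNReal.ofReal_pow hc]
      gcongr
      rw [← ofReal_norm]
      exact ENNReal.ofReal_le_ofReal (hg _)
    calc _ ≤ W s j * (ENNReal.ofReal (c ^ 2) * ‖a.val j‖ₑ ^ 2) := by gcongr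
      _ = _ := by ring
  have := mul_le_mul_of_nonneg_left h (CM_pos d s).le
  linarith

lemma abs_sinc_le (x : ℝ) : |sinc x| ≤ 1 := by
  unfold sinc
  split_ifs with h
  · simp
  · rw [abs_div, div_le_one (abs_pos.2 h)]
    exact Real.abs_sin_le_abs

lemma norm_sinc1 (y : ℝ) : ‖((sinc y : ℝ) : ℂ)‖ ≤ 1 := by
  rw [Complex.norm_real]; exact abs_sinc_le y
lemma norm_sinc2 (y : ℝ) : ‖((sinc y ^ 2 : ℝ) : ℂ)‖ ≤ 1 := by
  rw [Complex.norm_real, norm_pow]; exact pow_le_one₀ (norm_nonneg _) (abs_sinc_le y)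
lemma norm_sinc3 (y : ℝ) : ‖((sinc y - 1 : ℝ) : ℂ)‖ ≤ 2 := by
  rw [Complex.norm_real]
  refine (norm_sub_le _ _).trans ?_
  have := abs_sinc_le y
  rw [Real.norm_eq_abs, norm_one]; linarith
lemma norm_free (τ x : ℝ) : ‖Complex.exp (-Complex.I * (τ : ℂ) * ((x : ℂ)) ^ 2)‖ ≤ 1 := by
  have : -Complex.I * (τ : ℂ) * ((x : ℂ)) ^ 2 = ((-(τ * x ^ 2) : ℝ) : ℂ) * Complex.I := by
    push_cast; ring
  rw [this, Complex.norm_exp_ofReal_mul_I]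

/-- `sinc(τΩ)` -/
def S0 (τ : ℝ) : TA d K s →ₗ[ℂ] TA d K s := mulT (fun x => ((sinc (τ * x) : ℝ) : ℂ))
/-- `sinc(τΩ/2)²` -/
def S2 (τ : ℝ) : TA d K s →ₗ[ℂ] TA d K s := mulT (fun x => ((sinc (τ * x / 2) ^ 2 : ℝ) : ℂ))
/-- `sinc(τΩ)-1` -/
def S1 (τ : ℝ) : TA d K s →ₗ[ℂ] TA d K s := mulT (fun x => ((sinc (τ * x) - 1 : ℝ) : ℂ))
/-- free propagator -/
def FT (τ : ℝ) : TA d K s →ₗ[ℂ] TA d K s :=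
  mulT (fun x => Complex.exp (-Complex.I * (τ : ℂ) * ((x : ℂ)) ^ 2))

lemma norm_S0 (τ : ℝ) (a : TA d K s) : ‖S0 τ a‖ ≤ ‖a‖ := by
  have := norm_mulT_le zero_le_one (fun x => norm_sinc1 (τ * x)) a
  simpa [S0] using this
lemma norm_S2 (τ : ℝ) (a : TA d K s) : ‖S2 τ a‖ ≤ ‖a‖ := by
  have := norm_mulT_le zero_le_one (fun x => norm_sinc2 (τ * x / 2)) a
  rw [one_mul] at this
  exact this
lemma norm_S1 (τ : ℝ) (a : TA d K s) : ‖S1 τ a‖ ≤ 2 * ‖a‖ :=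
  norm_mulT_le zero_le_two (fun x => norm_sinc3 (τ * x)) a
lemma norm_FT (τ : ℝ) (a : TA d K s) : ‖FT τ a‖ ≤ ‖a‖ := by
  have := norm_mulT_le zero_le_one (fun x => norm_free τ x) a
  rw [one_mul] at this
  exact this

/-- `vNew` in the algebra -/
def vT (τ : ℝ) (u ud p : TA d K s) : TA d K s :=
  S0 τ u - ((τ / 2 : ℝ) : ℂ) • S2 τ ud + S1 τ (Q (absSq p.val))
/-- `vOrig` in the algebra -/
def vO (τ : ℝ) (u ud p : TA d K s) : TA d K s :=
  S0 τ u + ((τ / 2 : ℝ) : ℂ) • S2 τ ud + S1 τ (Q (absSq p.val))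
/-- `wNew` in the algebra -/
def wT (τ : ℝ) (ud p p' φ : TA d K s) : TA d K s :=
  S2 τ ud + S1 τ (Q (reC (conv (p + p').val (conjC φ.val))))

lemma vNew_eq (τ : ℝ) (u ud p : TA d K s) :
    vNew d K τ u.val ud.val p.val = (vT τ u ud p).val := rfl
lemma vOrig_eq (τ : ℝ) (u ud p : TA d K s) :
    vOrig d K τ u.val ud.val p.val = (vO τ u ud p).val := rfl
lemma wNew_eq (τ : ℝ) (ud p p' φ : TA d K s) :
    wNew d K τ ud.val p.val p'.val φ.val = (wT τ ud p p' φ).val := rfl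

lemma Q_exp_conv [P : Par d K s] (c : ℂ) (v x : TA d K s) :
    Q (conv (expC (c • v.val)) x.val) = NormedSpace.exp (c • v) * x :=
  EV_ext fun k => by
    have h1 : L1 (c • v.val) ≠ ⊤ := L1_smul_ne c v.L1
    rw [EV_Q k (L1_conv_ne (L1_expC h1) x.L1), EV_mul, EV_exp, EV_smul,
      E_conv K k (L1_expC h1) x.L1, E_expC K k h1, E_smul]; rfl

lemma psiStep_eq [P : Par d K s] (τ : ℝ) (v x : TA d K s) :
    psiStep d K τ v.val x.val =
      (FT τ (NormedSpace.exp ((-Complex.I * (τ : ℂ)) • v) * x)).val := by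
  rw [← Q_exp_conv]; rfl

lemma phiStepNew_eq [P : Par d K s] {τ : ℝ} (hτ : 0 < τ) (v w φ p : TA d K s) :
    phiStepNew d K τ v.val w.val φ.val p.val = (FT τ (stepA τ v w φ p)).val := by
  have key : (Q (conv (expC ((-Complex.I * (τ : ℂ)) • v.val))
    (φ.val - (Complex.I * (τ : ℂ)) • conv w.val
      (conv (phiC ((-Complex.I * (τ : ℂ) ^ 2) • w.val)) p.val))) : TA d K s) =
      stepA τ v w φ p := by
    apply EV_ext
    intro k
    have h1 : L1 ((-Complex.I * (τ : ℂ)) • v.val) ≠ ⊤ := L1_smul_ne _ v.L1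
    have h2 : L1 ((-Complex.I * (τ : ℂ) ^ 2) • w.val) ≠ ⊤ := L1_smul_ne _ w.L1
    have h3 := L1_conv_ne (L1_phiC h2) p.L1
    have h4 := L1_conv_ne w.L1 h3
    have h5 : φ.val - (Complex.I * (τ : ℂ)) • conv w.val
      (conv (phiC ((-Complex.I * (τ : ℂ) ^ 2) • w.val)) p.val) =
      φ.val + (-(Complex.I * (τ : ℂ))) • conv w.val
      (conv (phiC ((-Complex.I * (τ : ℂ) ^ 2) • w.val)) p.val) := by
      rw [neg_smul, sub_eq_add_neg]
    have h6 := L1_smul_ne (-(Complex.I * (τ : ℂ))) h4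
    rw [h5, EV_Q k (L1_conv_ne (L1_expC h1) (L1_add_ne φ.L1 h6)),
      E_conv K k (L1_expC h1) (L1_add_ne φ.L1 h6), E_expC K k h1, E_smul, E_add K k φ.L1 h6,
      E_smul, E_conv K k w.L1 h3, E_conv K k (L1_phiC h2) p.L1]
    have h7 := E_phiC K k h2
    rw [E_smul] at h7
    rw [stepA, EV_mul, EV_exp, EV_smul, EV_add, EV_smul, EV_mul, EV_sub, EV_exp, EV_smul, EV_one]
    change _ = Complex.exp (_ * E K k v.val) * (E K k φ.val + _ * ((Complex.exp
      (_ * E K k w.val) - 1) * E K k p.val))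
    rw [← h7]
    have hτ' : (τ : ℂ) ≠ 0 := by exact_mod_cast hτ.ne'
    field_simp
  rw [← key]; rfl

/-- wave step -/
def uT (τ : ℝ) (u ud q : TA d K s) : TA d K s :=
  mulT (fun x => ((Real.cos (τ * x) : ℝ) : ℂ)) (u + q) +
    mulT (fun x => ((τ * sinc (τ * x) : ℝ) : ℂ)) ud - q
/-- wave step, velocity -/
def udT (τ : ℝ) (u ud q : TA d K s) : TA d K s :=
  mulT (fun x => -((x * Real.sin (τ * x) : ℝ) : ℂ)) (u + q) +
    mulT (fun x => ((Real.cos (τ * x) : ℝ) : ℂ)) ud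

lemma uStep_eq1 (τ : ℝ) (u ud q : TA d K s) : (uStep τ u.val ud.val q.val).1 = (uT τ u ud q).val := by
  ext j
  simp [uStep, Rop, uT, mulT_val, mulOp]
  ring
lemma uStep_eq2 (τ : ℝ) (u ud q : TA d K s) : (uStep τ u.val ud.val q.val).2 = (udT τ u ud q).val := by
  ext j
  simp [uStep, Rop, udT, mulT_val, mulOp]
  ring

lemma sinc_ident (τ x : ℝ) :
    sinc (τ * x) * Real.cos (τ * x) + τ / 2 * sinc (τ * x / 2) ^ 2 * (x * Real.sin (τ * x))
      = sinc (τ * x) ∧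
    sinc (τ * x) * sinc (τ * x) - 1 / 2 * sinc (τ * x / 2) ^ 2 * Real.cos (τ * x)
      = 1 / 2 * sinc (τ * x / 2) ^ 2 := by
  by_cases h : τ * x = 0
  · rw [h]; norm_num [sinc]
  · have h2 : τ * x / 2 ≠ 0 := by simpa using h
    have hτ : τ ≠ 0 := left_ne_zero_of_mul h
    have hx : x ≠ 0 := right_ne_zero_of_mul h
    have hc : Real.sin (τ * x / 2) ^ 2 = (1 - Real.cos (τ * x)) / 2 := by
      have := Real.cos_two_mul (τ * x / 2)
      rw [mul_div_cancel₀ _ two_ne_zero] at this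
      have h3 := Real.sin_sq_add_cos_sq (τ * x / 2)
      linarith
    have h4 := Real.sin_sq_add_cos_sq (τ * x)
    simp only [sinc, h, h2, if_false, div_pow, hc]
    constructor
    · field_simp; ring
    · field_simp; linear_combination h4

lemma vO_eq_vT (τ : ℝ) (u ud p : TA d K s) :
    vO τ u ud p = vT τ (uT τ u ud (Q (absSq p.val))) (udT τ u ud (Q (absSq p.val))) p := by
  apply TA.ext'
  ext j
  have h := sinc_ident τ (absZ j)
  obtain ⟨h1, h2⟩ := h
  have h1' := congrArg (fun y : ℝ => (y : ℂ)) h1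
  have h2' := congrArg (fun y : ℝ => (y : ℂ)) h2
  generalize (Q (absSq p.val) : TA d K s) = q
  simp only [vO, vT, S0, S1, S2, uT, udT, TA.val_add, TA.val_sub, TA.val_smul, mulT_val, mulOp,
    Pi.add_apply, Pi.sub_apply, Pi.smul_apply, smul_eq_mul]
  push_cast at h1' h2' ⊢
  linear_combination (-(u.val j) - q.val j) * h1' - τ * ud.val j * h2'

lemma vO_eq_add [P : Par d K s] {τ : ℝ} (hτ : 0 < τ) (u ud p p' : TA d K s) :
    vO τ u ud p = vT τ u ud p' + (τ : ℂ) • wT τ ud p p' ((τ : ℂ)⁻¹ • (p - p')) := by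
  have hτ' : (τ : ℂ) ≠ 0 := by exact_mod_cast hτ.ne'
  have hq : (Q (absSq p.val) : TA d K s) = Q (absSq p'.val) +
      (τ : ℂ) • (Q (reC (conv (p + p').val (conjC ((τ : ℂ)⁻¹ • (p - p')).val))) : TA d K s) := by
    rw [Q_absSq, Q_absSq, Q_reC]
    apply EV_ext
    intro k
    simp only [EV_add, EV_mul, EV_smul, EV_bar, EV_sub, map_mul, map_add, map_sub, map_inv₀,
      Complex.conj_ofReal]
    field_simp
    ring
  rw [vO, vT, wT, hq]
  simp only [map_add, map_smul, smul_add, smul_smul]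
  have : ((τ : ℝ) : ℂ) • S2 τ ud = ((τ / 2 : ℝ) : ℂ) • S2 τ ud + ((τ / 2 : ℝ) : ℂ) • S2 τ ud := by
    rw [← add_smul]; congr 1; push_cast; ring
  rw [this]
  abel

/-- The recurrence in new variables. -/
lemma step_rec [P : Par d K s] {τ : ℝ} (hτ : 0 < τ) (v w p p' : TA d K s)
    (hp : p = FT τ (NormedSpace.exp ((-Complex.I * (τ : ℂ)) • v) * p')) :
    (τ : ℂ)⁻¹ • (FT τ (NormedSpace.exp ((-Complex.I * (τ : ℂ)) • (v + (τ : ℂ) • w)) * p) - p) =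
      FT τ (stepA τ v w ((τ : ℂ)⁻¹ • (p - p')) p) := by
  have hτ' : (τ : ℂ) ≠ 0 := by exact_mod_cast hτ.ne'
  have h : FT τ (NormedSpace.exp ((-Complex.I * (τ : ℂ)) • (v + (τ : ℂ) • w)) * p) - p
      = FT τ (NormedSpace.exp ((-Complex.I * (τ : ℂ)) • (v + (τ : ℂ) • w)) * p -
        NormedSpace.exp ((-Complex.I * (τ : ℂ)) • v) * p') := by
    rw [map_sub, ← hp]
  rw [h, ← map_smul]
  congr 1
  apply EV_ext
  intro k
  simp only [stepA, EV_add, EV_mul, EV_smul, EV_sub, EV_exp, EV_one, mul_add, Complex.exp_add]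
  have : -Complex.I * (τ : ℂ) * (τ * EV k w) = -Complex.I * (τ : ℂ) ^ 2 * EV k w := by ring
  rw [this]
  field_simp
  ring

end Link
end Part6

section Part7
section Bounds
variable {d K : ℕ} {s : ℝ}

lemma CI_one_le (d : ℕ) (s : ℝ) : 1 ≤ CI d s := by
  unfold CI; have := Real.sqrt_nonneg (Binterp d s).toReal; linarith

lemma norm_re_le [P : Par d K s] (p φ : TA d K s) :
    ‖(1 / 2 : ℂ) • (p * bar φ + bar p * φ)‖ ≤ CI d s * (‖p‖ * ‖φ‖) := by
  rw [norm_smul]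
  have h1 : ‖p * bar φ‖ ≤ ‖p‖ * (CI d s * ‖φ‖) :=
    (norm_mul_le _ _).trans (by gcongr; exact norm_bar_le φ)
  have h2 : ‖bar p * φ‖ ≤ (CI d s * ‖p‖) * ‖φ‖ :=
    (norm_mul_le _ _).trans (by gcongr; exact norm_bar_le p)
  have h3 := norm_add_le (p * bar φ) (bar p * φ)
  have h4 : ‖(1 / 2 : ℂ)‖ = 1 / 2 := by norm_num
  rw [h4]
  linarith

lemma norm_vT_le [P : Par d K s] {τ T B : ℝ} (hτ : 0 < τ) (hτT : τ ≤ T) (hB : 0 ≤ B)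
    {u ud p : TA d K s} (hu : ‖u‖ ≤ B) (hud : ‖ud‖ ≤ B) (hp : ‖p‖ ≤ B) :
    ‖vT τ u ud p‖ ≤ (1 + T + 8 * CI d s * B) * B := by
  have hc := CI_one_le d s
  rw [vT, Q_absSq]
  have h1 := norm_S0 τ u
  have h2 := norm_S2 τ ud
  have h3 := norm_S1 τ (p * bar p)
  have h4 : ‖p * bar p‖ ≤ B * (CI d s * B) := by
    refine (norm_mul_le _ _).trans ?_
    have := norm_bar_le p
    gcongr
    exact this.trans (by gcongr)
  have h5 : ‖((τ / 2 : ℝ) : ℂ) • S2 τ ud‖ ≤ T * B := by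
    rw [norm_smul, Complex.norm_real, Real.norm_of_nonneg (by positivity)]
    have : τ / 2 ≤ T := by linarith
    exact mul_le_mul this (h2.trans hud) (norm_nonneg _) (by linarith)
  have h6 := norm_add_le (S0 τ u - ((τ / 2 : ℝ) : ℂ) • S2 τ ud) (S1 τ (p * bar p))
  have h7 := norm_sub_le (S0 τ u) (((τ / 2 : ℝ) : ℂ) • S2 τ ud)
  nlinarith [mul_nonneg (mul_nonneg hB hB) (by linarith : 0 ≤ CI d s)]

lemma norm_vT_sub_le [P : Par d K s] {τ T B e : ℝ} (hτ : 0 < τ) (hτT : τ ≤ T) (hB : 0 ≤ B)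
    (he : 0 ≤ e) {u ud p u' ud' p' : TA d K s}
    (hp : ‖p‖ ≤ B) (hp' : ‖p'‖ ≤ B)
    (eu : ‖u - u'‖ ≤ e) (eud : ‖ud - ud'‖ ≤ e) (ep : ‖p - p'‖ ≤ e) :
    ‖vT τ u ud p - vT τ u' ud' p'‖ ≤ (1 + T + 8 * CI d s * B) * e := by
  have hc := CI_one_le d s
  have hdec : vT τ u ud p - vT τ u' ud' p' = S0 τ (u - u') - ((τ / 2 : ℝ) : ℂ) • S2 τ (ud - ud')
      + S1 τ ((p - p') * bar p + p' * bar (p - p')) := by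
    have : p * bar p = p' * bar p' + ((p - p') * bar p + p' * bar (p - p')) := by
      rw [bar_sub]; ring
    rw [vT, vT, Q_absSq, Q_absSq, this]
    simp only [map_add, map_sub, smul_sub]
    abel
  rw [hdec]
  have h1 := norm_S0 τ (u - u')
  have h2 := norm_S2 τ (ud - ud')
  have h3 := norm_S1 τ ((p - p') * bar p + p' * bar (p - p'))
  have h4 : ‖(p - p') * bar p‖ ≤ e * (CI d s * B) := by
    refine (norm_mul_le _ _).trans ?_
    have := norm_bar_le p
    gcongr
    exact this.trans (by gcongr)
  have h4' : ‖p' * bar (p - p')‖ ≤ B * (CI d s * e) := by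
    refine (norm_mul_le _ _).trans ?_
    have := norm_bar_le (p - p')
    gcongr
    exact this.trans (by gcongr)
  have h4'' := norm_add_le ((p - p') * bar p) (p' * bar (p - p'))
  have h5 : ‖((τ / 2 : ℝ) : ℂ) • S2 τ (ud - ud')‖ ≤ T * e := by
    rw [norm_smul, Complex.norm_real, Real.norm_of_nonneg (by positivity)]
    have : τ / 2 ≤ T := by linarith
    exact mul_le_mul this (h2.trans eud) (norm_nonneg _) (by linarith)
  have h6 := norm_add_le (S0 τ (u - u') - ((τ / 2 : ℝ) : ℂ) • S2 τ (ud - ud'))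
    (S1 τ ((p - p') * bar p + p' * bar (p - p')))
  have h7 := norm_sub_le (S0 τ (u - u')) (((τ / 2 : ℝ) : ℂ) • S2 τ (ud - ud'))
  nlinarith [mul_nonneg (mul_nonneg hB he) (by linarith : 0 ≤ CI d s)]

lemma norm_wT_le [P : Par d K s] {τ T B : ℝ} (hT : 0 ≤ T) (hB : 0 ≤ B)
    {ud p q φ : TA d K s} (hud : ‖ud‖ ≤ B) (hp : ‖p‖ ≤ B) (hq : ‖q‖ ≤ B) (hφ : ‖φ‖ ≤ B) :
    ‖wT τ ud p q φ‖ ≤ (1 + T + 8 * CI d s * B) * B := by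
  have hc := CI_one_le d s
  rw [wT, Q_reC]
  have h2 := norm_S2 τ ud
  have h3 := norm_S1 τ ((1 / 2 : ℂ) • ((p + q) * bar φ + bar (p + q) * φ))
  have h4 := norm_re_le (p + q) φ
  have h5 : CI d s * (‖p + q‖ * ‖φ‖) ≤ CI d s * ((2 * B) * B) := by
    have : ‖p + q‖ ≤ 2 * B := (norm_add_le _ _).trans (by linarith)
    gcongr
  have h6 := norm_add_le (S2 τ ud) (S1 τ ((1 / 2 : ℂ) • ((p + q) * bar φ + bar (p + q) * φ)))
  nlinarith [mul_nonneg (mul_nonneg hB hB) (by linarith : 0 ≤ CI d s), mul_nonneg hT hB]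

lemma norm_wT_sub_le [P : Par d K s] {τ T B e : ℝ} (hT : 0 ≤ T) (hB : 0 ≤ B) (he : 0 ≤ e)
    {ud p q φ ud' p' q' φ' : TA d K s} (hφ : ‖φ‖ ≤ B) (hp' : ‖p'‖ ≤ B) (hq' : ‖q'‖ ≤ B)
    (eud : ‖ud - ud'‖ ≤ e) (ep : ‖p - p'‖ ≤ e) (eq : ‖q - q'‖ ≤ e) (eφ : ‖φ - φ'‖ ≤ e) :
    ‖wT τ ud p q φ - wT τ ud' p' q' φ'‖ ≤ (1 + T + 8 * CI d s * B) * e := by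
  have hc := CI_one_le d s
  obtain ⟨x, hx⟩ : ∃ x, x = (1 / 2 : ℂ) • (((p - p') + (q - q')) * bar φ +
    bar ((p - p') + (q - q')) * φ) := ⟨_, rfl⟩
  obtain ⟨y, hy⟩ : ∃ y, y = (1 / 2 : ℂ) • ((p' + q') * bar (φ - φ') +
    bar (p' + q') * (φ - φ')) := ⟨_, rfl⟩
  have hdec : wT τ ud p q φ - wT τ ud' p' q' φ' = S2 τ (ud - ud') + S1 τ (x + y) := by
    have : (1 / 2 : ℂ) • ((p + q) * bar φ + bar (p + q) * φ) =
        (1 / 2 : ℂ) • ((p' + q') * bar φ' + bar (p' + q') * φ') + (x + y) := by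
      rw [hx, hy, ← smul_add, ← smul_add]
      congr 1
      simp only [bar_add, bar_sub]
      ring
    rw [wT, wT, Q_reC, Q_reC, this]
    simp only [map_add, map_sub]
    abel
  rw [hdec]
  have h2 := norm_S2 τ (ud - ud')
  have h3 := norm_S1 τ (x + y)
  have hx1 : ‖x‖ ≤ CI d s * ((2 * e) * B) := by
    rw [hx]
    refine (norm_re_le _ _).trans ?_
    have : ‖(p - p') + (q - q')‖ ≤ 2 * e := (norm_add_le _ _).trans (by linarith)
    gcongr
  have hy1 : ‖y‖ ≤ CI d s * ((2 * B) * e) := by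
    rw [hy]
    refine (norm_re_le _ _).trans ?_
    have : ‖p' + q'‖ ≤ 2 * B := (norm_add_le _ _).trans (by linarith)
    gcongr
  have h5 := norm_add_le x y
  have h6 := norm_add_le (S2 τ (ud - ud')) (S1 τ (x + y))
  nlinarith [mul_nonneg (mul_nonneg hB he) (by linarith : 0 ≤ CI d s), mul_nonneg hT he]

/-- The full step in the algebra. -/
def stepF (τ : ℝ) [P : Par d K s] (u ud φ p q : TA d K s) : TA d K s :=
  FT τ (stepA τ (vT τ u ud q) (wT τ ud p q φ) φ p)

lemma stepF_lip (d : ℕ) (s B T : ℝ) (hB : 0 ≤ B) (hT : 0 ≤ T) : ∃ C, 0 ≤ C ∧ ∀ (K : ℕ)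
    [P : Par d K s] (τ : ℝ), 0 < τ → τ ≤ T → ∀ (e : ℝ) (u ud φ p q u' ud' φ' p' q' : TA d K s),
    ‖u‖ ≤ B → ‖ud‖ ≤ B → ‖φ‖ ≤ B → ‖p‖ ≤ B → ‖q‖ ≤ B →
    ‖u'‖ ≤ B → ‖ud'‖ ≤ B → ‖φ'‖ ≤ B → ‖p'‖ ≤ B → ‖q'‖ ≤ B →
    ‖u - u'‖ ≤ e → ‖ud - ud'‖ ≤ e → ‖φ - φ'‖ ≤ e → ‖p - p'‖ ≤ e → ‖q - q'‖ ≤ e →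
    ‖stepF τ u ud φ p q - stepF τ u' ud' φ' p' q'‖ ≤ ‖φ - φ'‖ + C * τ * e := by
  have hc := CI_one_le d s
  obtain ⟨L, hL⟩ : ∃ L, L = 1 + T + 8 * CI d s * B := ⟨_, rfl⟩
  have hL1 : 1 ≤ L := by
    rw [hL]
    have : 0 ≤ 8 * CI d s * B := by positivity
    linarith
  obtain ⟨C, hC, h⟩ := stepA_lip (L * B) T (by positivity) hT
  refine ⟨C * L, by positivity, ?_⟩
  intro K P τ hτ hτT e u ud φ p q u' ud' φ' p' q' hu hud hφ hp hq hu' hud' hφ' hp' hq' eu eud eφ ep eq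
  have he : 0 ≤ e := (norm_nonneg _).trans eu
  have hLB : B ≤ L * B := le_mul_of_one_le_left hB hL1
  have hLe : e ≤ L * e := le_mul_of_one_le_left he hL1
  have key := h (TA d K s) τ hτ hτT (L * e) (vT τ u ud q) (wT τ ud p q φ) φ p
    (vT τ u' ud' q') (wT τ ud' p' q' φ') φ' p'
    (by rw [hL]; exact norm_vT_le hτ hτT hB hu hud hq)
    (by rw [hL]; exact norm_wT_le hT hB hud hp hq hφ)
    (hφ.trans hLB) (hp.trans hLB)
    (by rw [hL]; exact norm_vT_le hτ hτT hB hu' hud' hq')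
    (by rw [hL]; exact norm_wT_le hT hB hud' hp' hq' hφ')
    (hφ'.trans hLB) (hp'.trans hLB)
    (by rw [hL]; exact norm_vT_sub_le hτ hτT hB he hq hq' eu eud eq)
    (by rw [hL]; exact norm_wT_sub_le hT hB he hφ hp' hq' eud ep eq eφ)
    (eφ.trans hLe) (ep.trans hLe)
  rw [stepF, stepF, ← map_sub]
  refine (norm_FT τ _).trans (key.trans (le_of_eq ?_))
  ring

lemma sobNorm_mono {v : Coef d} (hv : isTrig d K v) {s t : ℝ} (h : s ≤ t) :
    sobNorm s v ≤ sobNorm t v := by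
  rw [sobNorm_eq, sobNorm_eq]
  apply Real.sqrt_le_sqrt
  apply ENNReal.toReal_mono (H_trig t hv)
  exact ENNReal.tsum_le_tsum fun j => by
    have := W_mono h j
    gcongr

lemma le_pairNorm1 (v w : Coef d) : sobNorm (s + 1) v ≤ pairNorm s v w :=
  Real.le_sqrt_of_sq_le (by nlinarith [sq_nonneg (sobNorm s w)])
lemma le_pairNorm2 (v w : Coef d) : sobNorm s w ≤ pairNorm s v w :=
  Real.le_sqrt_of_sq_le (by nlinarith [sq_nonneg (sobNorm (s + 1) v)])
lemma pairNorm_nonneg (v w : Coef d) : 0 ≤ pairNorm s v w := Real.sqrt_nonneg _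

lemma isTrig_sub {v w : Coef d} (hv : isTrig d K v) (hw : isTrig d K w) : isTrig d K (v - w) :=
  fun j hj => by simp [hv j hj, hw j hj]
lemma isTrig_smul (c : ℂ) {v : Coef d} (hv : isTrig d K v) : isTrig d K (c • v) :=
  fun j hj => by simp [hv j hj]
lemma isTrig_freeOp (τ : ℝ) {v : Coef d} (hv : isTrig d K v) : isTrig d K (freeOp τ v) :=
  fun j hj => by simp [freeOp, mulOp, hv j hj]

lemma isTrig_phiK {ψ u : ℝ → Coef d} (t : ℝ) (h : isTrig d K (ψ t)) :
    isTrig d K (phiK d K ψ u t) := fun j hj => by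
  simp [phiK, h j hj, isTrig_interp d K _ j hj]

lemma trig_seq {τ : ℝ} {ψn un udn : ℕ → Coef d} (h : LieTrotter d K τ ψn un udn)
    (h1 : isTrig d K (ψn 0)) (h2 : isTrig d K (un 0)) (h3 : isTrig d K (udn 0)) (n : ℕ) :
    isTrig d K (ψn n) ∧ isTrig d K (un n) ∧ isTrig d K (udn n) := by
  induction n with
  | zero => exact ⟨h1, h2, h3⟩
  | succ n ih =>
    obtain ⟨a, b, c⟩ := h n
    rw [a, b, c]
    refine ⟨isTrig_freeOp τ (isTrig_interp d K _), ?_, ?_⟩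
    · intro j hj
      simp [uStep, Rop, ih.2.1 j hj, ih.2.2 j hj, isTrig_interp d K _ j hj]
    · intro j hj
      simp [uStep, Rop, ih.2.1 j hj, ih.2.2 j hj, isTrig_interp d K _ j hj]

lemma le_errFull (τ t₀ : ℝ) (ψK uK udK : ℝ → Coef d) (ψn un udn : ℕ → Coef d) {m n : ℕ}
    (h1 : 1 ≤ m) (h2 : m ≤ n) :
    sobNorm s (phiK d K ψK uK (t₀ + (m : ℝ) * τ) - phin τ ψn m)
      + pairNorm s (uK (t₀ + (m : ℝ) * τ) - un m) (udK (t₀ + (m : ℝ) * τ) - udn m)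
      ≤ errFull d K s τ t₀ ψK uK udK ψn un udn n := by
  apply le_csSup ((Set.finite_Icc 1 n).image _).bddAbove
  exact ⟨m, ⟨h1, h2⟩, rfl⟩

lemma errFull_nonneg (τ t₀ : ℝ) (ψK uK udK : ℝ → Coef d) (ψn un udn : ℕ → Coef d) (n : ℕ) :
    0 ≤ errFull d K s τ t₀ ψK uK udK ψn un udn n := by
  apply Real.sSup_nonneg
  rintro _ ⟨m, _, rfl⟩
  exact add_nonneg (sobNorm_nonneg _ _) (pairNorm_nonneg _ _)

/-- Recurrence for the fully discrete solution. -/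
lemma rec_phin [P : Par d K s] {τ : ℝ} (hτ : 0 < τ) {ψn un udn : ℕ → Coef d}
    (h : LieTrotter d K τ ψn un udn)
    {p u ud : ℕ → TA d K s} (hp : ∀ n, (p n).val = ψn n) (hu : ∀ n, (u n).val = un n)
    (hud : ∀ n, (ud n).val = udn n) (m : ℕ) :
    (τ : ℂ)⁻¹ • (p (m + 2) - p (m + 1)) =
      stepF τ (u (m + 1)) (ud (m + 1)) ((τ : ℂ)⁻¹ • (p (m + 1) - p m)) (p (m + 1)) (p m) := by
  have hψ : ∀ n, p (n + 1) = FT τ (NormedSpace.exp ((-Complex.I * (τ : ℂ)) •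
      (vO τ (u n) (ud n) (p n))) * p n) := by
    intro n
    apply TA.ext'
    rw [hp, (h n).1, ← psiStep_eq, ← vOrig_eq, hp, hu, hud]
  have hu' : ∀ n, u (n + 1) = uT τ (u n) (ud n) (Q (absSq (p n).val)) := by
    intro n
    apply TA.ext'
    rw [← uStep_eq1, hu, (h n).2.1, hu, hud, hp]; rfl
  have hud' : ∀ n, ud (n + 1) = udT τ (u n) (ud n) (Q (absSq (p n).val)) := by
    intro n
    apply TA.ext'
    rw [← uStep_eq2, hud, (h n).2.2, hu, hud, hp]; rfl
  have e1 : vO τ (u m) (ud m) (p m) = vT τ (u (m + 1)) (ud (m + 1)) (p m) := by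
    rw [hu' m, hud' m]; exact vO_eq_vT τ _ _ _
  have e2 := vO_eq_add hτ (u (m + 1)) (ud (m + 1)) (p (m + 1)) (p m)
  have e3 := hψ (m + 1)
  have e4 := hψ m
  rw [e1] at e4
  rw [e2] at e3
  have := step_rec hτ (vT τ (u (m + 1)) (ud (m + 1)) (p m))
    (wT τ (ud (m + 1)) (p (m + 1)) (p m) ((τ : ℂ)⁻¹ • (p (m + 1) - p m))) (p (m + 1)) (p m) e4
  rw [← e3] at this
  exact this

lemma norm_sum_le' {A : Type*} [SeminormedAddCommGroup A] {n : ℕ} {f : ℕ → A} {b : ℝ}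
    (h : ∀ i, i < n → ‖f i‖ ≤ b) : ‖∑ i ∈ Finset.range n, f i‖ ≤ n * b := by
  refine (norm_sum_le_of_le _ (fun i hi => h i (Finset.mem_range.1 hi))).trans ?_
  simp

end Bounds
end Part7

/-- **Proposition (stability in `φ`).** Under the regularity and a priori bounds,
`‖φ̂_{n+1}^K - φ_{n+1}^K‖ₛ ≤ ‖φ^K(t_n) - φ_n^K‖ₛ + C τ e_n^K` for `τ ≤ t_n - t₀ ≤ T`. -/
theorem stability_phi (d : ℕ) (hd : 1 ≤ d) (s σ M T c C₀ : ℝ)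
    (hs : (d : ℝ) / 2 < s) (hσ : 2 ≤ σ) (hM : 1 ≤ M) (hT : 0 < T)
    (hc : c < 2 * Real.pi) :
    ∃ C : ℝ, ∀ (K : ℕ) (τ : ℝ), 0 < τ →
      ∀ (ψ u ud ψK uK udK : ℝ → Coef d) (ψn un udn : ℕ → Coef d) (t₀ : ℝ),
        ZakSol d ψ u ud →
        regBound d s σ M T t₀ ψ u ud →
        ZakSolK d K ψK uK udK →
        initK d K t₀ ψ u ud ψK uK udK →
        regHighK d K s C₀ T t₀ ψK uK udK →
        LieTrotter d K τ ψn un udn →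
        initFull d K t₀ ψ u ud ψn un udn →
        aprioriFull s (2 * C₀ * M) T τ ψn un udn →
        ∀ n : ℕ, 1 ≤ n → (n : ℝ) * τ ≤ T →
          sobNorm s (phihatSucc d K τ t₀ ψK uK udK n - phin τ ψn (n + 1))
            ≤ sobNorm s (phiK d K ψK uK (t₀ + (n : ℝ) * τ) - phin τ ψn n)
              + C * τ * errFull d K s τ t₀ ψK uK udK ψn un udn n := by
  obtain ⟨R, hR⟩ : ∃ R, R = |C₀| + 2 * |C₀| * M := ⟨_, rfl⟩
  have hR0 : 0 ≤ R := by rw [hR]; positivity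
  have hCM := CM_pos d s
  have hRC : C₀ ≤ R := by
    rw [hR]
    have h1 := le_abs_self C₀
    have h2 : 0 ≤ 2 * |C₀| * M := by positivity
    linarith
  have hRM : 2 * C₀ * M ≤ R := by
    rw [hR]
    have h1 := le_abs_self C₀
    have h2 : 2 * C₀ * M ≤ 2 * |C₀| * M := by gcongr
    linarith [abs_nonneg C₀]
  obtain ⟨C, hC, hlip⟩ := stepF_lip d s ((1 + T) * (CM d s * R)) T (by positivity) hT.le
  refine ⟨C * (1 + T), ?_⟩
  intro K τ hτ ψ u ud ψK uK udK ψn un udn t₀ _ _ hZK hiK hreg hLT hiF hap n hn hnT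
  have herr0 : 0 ≤ errFull d K s τ t₀ ψK uK udK ψn un udn n :=
    errFull_nonneg τ t₀ ψK uK udK ψn un udn n
  have htr := trig_seq hLT (by rw [hiF.1]; exact isTrig_interp d K _)
    (by rw [hiF.2.1]; exact isTrig_interp d K _) (by rw [hiF.2.2]; exact isTrig_interp d K _)
  have hφtr : ∀ n, isTrig d K (phin τ ψn n) := fun n =>
    isTrig_smul _ (isTrig_sub (htr n).1 (htr (n - 1)).1)
  have hφK : ∀ t, isTrig d K (phiK d K ψK uK t) := fun t => isTrig_phiK t (hZK.1 t).1
  by_cases hK : K = 0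
  · have hz : phihatSucc d K τ t₀ ψK uK udK n - phin τ ψn (n + 1) = 0 := by
      funext j
      have hj : ¬ inK d K j := by
        intro h
        have := h ⟨0, hd⟩
        rw [hK] at this
        simp at this
        omega
      exact isTrig_sub (K := K) (isTrig_freeOp τ (isTrig_interp d K _)) (hφtr (n + 1)) j hj
    rw [hz]
    have h0 : sobNorm s (0 : Coef d) = 0 := by simp [sobNorm]
    rw [h0]
    have := sobNorm_nonneg s (phiK d K ψK uK (t₀ + (n : ℝ) * τ) - phin τ ψn n)
    positivity
  have P : Par d K s := ⟨hd, hK, hs⟩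
  obtain ⟨m, rfl⟩ : ∃ m, n = m + 1 := ⟨n - 1, by omega⟩
  set err := errFull d K s τ t₀ ψK uK udK ψn un udn (m + 1) with herr
  -- lifts to the algebra
  let p : ℕ → TA d K s := fun n => TA.mk (ψn n) (htr n).1
  let a : ℕ → TA d K s := fun n => TA.mk (un n) (htr n).2.1
  let b : ℕ → TA d K s := fun n => TA.mk (udn n) (htr n).2.2
  let f : ℕ → TA d K s := fun n => TA.mk (phin τ ψn n) (hφtr n)
  let a' : ℕ → TA d K s := fun n => TA.mk (uK (t₀ + (n : ℝ) * τ)) (hZK.1 _).2.1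
  let b' : ℕ → TA d K s := fun n => TA.mk (udK (t₀ + (n : ℝ) * τ)) (hZK.1 _).2.2
  let f' : ℕ → TA d K s := fun n => TA.mk (phiK d K ψK uK (t₀ + (n : ℝ) * τ)) (hφK _)
  let p' : ℕ → TA d K s := fun n => p 0 + (τ : ℂ) • ∑ i ∈ Finset.range n, f' (i + 1)
  have hτ' : (τ : ℂ) ≠ 0 := by exact_mod_cast hτ.ne'
  have hf : ∀ n, f (n + 1) = (τ : ℂ)⁻¹ • (p (n + 1) - p n) := fun n => rfl
  have hp : ∀ n, p n = p 0 + (τ : ℂ) • ∑ i ∈ Finset.range n, f (i + 1) := by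
    intro n
    induction n with
    | zero => simp
    | succ n ih =>
      rw [Finset.sum_range_succ, smul_add, ← add_assoc, ← ih, hf, smul_smul,
        mul_inv_cancel₀ hτ', one_smul]
      abel
  have hval : ∀ (n : ℕ) (g : ℕ → TA d K s),
      (∑ i ∈ Finset.range n, g i).val = ∑ i ∈ Finset.range n, (g i).val := by
    intro n g
    induction n with
    | zero => rfl
    | succ n ih => rw [Finset.sum_range_succ, Finset.sum_range_succ, TA.val_add, ih]
  have hp' : ∀ n, (p' n).val = psiIhat d K τ t₀ ψK uK n := by
    intro n
    have h0 : (p 0).val = ψK t₀ := by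
      change ψn 0 = _
      rw [hiF.1, hiK.1]
    change (p 0).val + (τ : ℂ) • (∑ i ∈ Finset.range n, f' (i + 1)).val = _
    rw [hval, h0, psiIhat]
    congr 2
    apply Finset.sum_congr rfl
    intro i _
    change phiK d K ψK uK (t₀ + ((i + 1 : ℕ) : ℝ) * τ) = _
    push_cast
    rfl
  -- the two steps
  have hstep : f (m + 2) = stepF τ (a (m + 1)) (b (m + 1)) (f (m + 1)) (p (m + 1)) (p m) :=
    rec_phin hτ hLT (p := p) (u := a) (ud := b) (fun _ => rfl) (fun _ => rfl) (fun _ => rfl) m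
  have hstep' : phihatSucc d K τ t₀ ψK uK udK (m + 1) =
      (stepF τ (a' (m + 1)) (b' (m + 1)) (f' (m + 1)) (p' (m + 1)) (p' m)).val := by
    rw [stepF, ← phiStepNew_eq hτ, ← vNew_eq, ← wNew_eq, hp', hp']
    rfl
  -- bounds
  have hmono : ∀ i, i ≤ m + 1 → (i : ℝ) * τ ≤ T := by
    intro i hi
    refine le_trans ?_ hnT
    gcongr
  have hregi : ∀ i, i ≤ m + 1 → sobNorm (s + 4) (ψK (t₀ + (i : ℝ) * τ)) +
      pairNorm (s + 2) (uK (t₀ + (i : ℝ) * τ)) (udK (t₀ + (i : ℝ) * τ))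
      + sobNorm (s + 2) (phiK d K ψK uK (t₀ + (i : ℝ) * τ)) ≤ C₀ := by
    intro i hi
    apply hreg
    · have : 0 ≤ (i : ℝ) * τ := by positivity
      linarith
    · linarith [hmono i hi]
  have hB1 : ∀ x : TA d K s, sobNorm s x.val ≤ R → ‖x‖ ≤ CM d s * R := by
    intro x hx
    rw [TA.norm_def]
    gcongr
  have hE1 : ∀ x : TA d K s, sobNorm s x.val ≤ err → ‖x‖ ≤ CM d s * err := by
    intro x hx
    rw [TA.norm_def]
    gcongr
  have hBle : CM d s * R ≤ (1 + T) * (CM d s * R) :=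
    le_mul_of_one_le_left (by positivity) (by linarith)
  have hEle : CM d s * err ≤ (1 + T) * (CM d s * err) :=
    le_mul_of_one_le_left (by positivity) (by linarith)
  have bf' : ∀ i, i ≤ m + 1 → ‖f' i‖ ≤ CM d s * R := by
    intro i hi
    apply hB1
    have h1 := hregi i hi
    have h2 := sobNorm_nonneg (s + 4) (ψK (t₀ + (i : ℝ) * τ))
    have h3 := pairNorm_nonneg (s := s + 2) (uK (t₀ + (i : ℝ) * τ)) (udK (t₀ + (i : ℝ) * τ))
    have h4 := sobNorm_mono (hφK (t₀ + (i : ℝ) * τ)) (by linarith : s ≤ s + 2)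
    change sobNorm s (phiK d K ψK uK (t₀ + (i : ℝ) * τ)) ≤ R
    linarith
  have ba' : ‖a' (m + 1)‖ ≤ CM d s * R := by
    apply hB1
    have h1 := hregi (m + 1) le_rfl
    obtain ⟨t, ht⟩ : ∃ t, t = t₀ + ((m + 1 : ℕ) : ℝ) * τ := ⟨_, rfl⟩
    rw [← ht] at h1
    have h2 := sobNorm_nonneg (s + 4) (ψK t)
    have h3 := sobNorm_nonneg (s + 2) (phiK d K ψK uK t)
    have h4 := sobNorm_mono (hZK.1 t).2.1 (by linarith : s ≤ s + 2 + 1)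
    have h5 := le_pairNorm1 (s := s + 2) (uK t) (udK t)
    change sobNorm s (uK (t₀ + ((m + 1 : ℕ) : ℝ) * τ)) ≤ R
    rw [← ht]
    linarith
  have bb' : ‖b' (m + 1)‖ ≤ CM d s * R := by
    apply hB1
    have h1 := hregi (m + 1) le_rfl
    obtain ⟨t, ht⟩ : ∃ t, t = t₀ + ((m + 1 : ℕ) : ℝ) * τ := ⟨_, rfl⟩
    rw [← ht] at h1
    have h2 := sobNorm_nonneg (s + 4) (ψK t)
    have h3 := sobNorm_nonneg (s + 2) (phiK d K ψK uK t)
    have h4 := sobNorm_mono (hZK.1 t).2.2 (by linarith : s ≤ s + 2)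
    have h5 := le_pairNorm2 (s := s + 2) (uK t) (udK t)
    change sobNorm s (udK (t₀ + ((m + 1 : ℕ) : ℝ) * τ)) ≤ R
    rw [← ht]
    linarith
  have bp0 : ‖p 0‖ ≤ CM d s * R := by
    apply hB1
    have h1 := hreg t₀ le_rfl (by linarith)
    have h2 := sobNorm_mono (hZK.1 t₀).1 (by linarith : s ≤ s + 4)
    have h3 := sobNorm_nonneg (s + 2) (phiK d K ψK uK t₀)
    have h4 := pairNorm_nonneg (s := s + 2) (uK t₀) (udK t₀)
    change sobNorm s (ψn 0) ≤ R
    rw [hiF.1, ← hiK.1]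
    linarith
  have bf : ∀ i, 1 ≤ i → i ≤ m + 1 → ‖f i‖ ≤ CM d s * R := by
    intro i h1 h2
    apply hB1
    have h3 := hap i h1 (hmono i h2)
    have h4 := pairNorm_nonneg (s := s) (un i) (udn i)
    change sobNorm s (phin τ ψn i) ≤ R
    linarith
  have ba : ‖a (m + 1)‖ ≤ CM d s * R := by
    apply hB1
    have h3 := hap (m + 1) hn hnT
    have h4 := sobNorm_nonneg s (phin τ ψn (m + 1))
    have h5 := le_pairNorm1 (s := s) (un (m + 1)) (udn (m + 1))
    have h6 := sobNorm_mono (htr (m + 1)).2.1 (by linarith : s ≤ s + 1)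
    change sobNorm s (un (m + 1)) ≤ R
    linarith
  have bb : ‖b (m + 1)‖ ≤ CM d s * R := by
    apply hB1
    have h3 := hap (m + 1) hn hnT
    have h4 := sobNorm_nonneg s (phin τ ψn (m + 1))
    have h5 := le_pairNorm2 (s := s) (un (m + 1)) (udn (m + 1))
    change sobNorm s (udn (m + 1)) ≤ R
    linarith
  have hsmul : ∀ x : TA d K s, ‖(τ : ℂ) • x‖ = τ * ‖x‖ := by
    intro x; rw [norm_smul, Complex.norm_real, Real.norm_of_nonneg hτ.le]
  have hsum : ∀ (i : ℕ) (g : ℕ → TA d K s) (β : ℝ), i ≤ m + 1 → 0 ≤ β →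
      (∀ l, l < i → ‖g l‖ ≤ β) → ‖(τ : ℂ) • ∑ l ∈ Finset.range i, g l‖ ≤ T * β := by
    intro i g β hi hβ hg
    rw [hsmul]
    have h1 := norm_sum_le' hg
    calc _ ≤ τ * (i * β) := by gcongr
      _ = (i * τ) * β := by ring
      _ ≤ T * β := by
        have := hmono i hi
        gcongr
  have bp' : ∀ i, i ≤ m + 1 → ‖p' i‖ ≤ (1 + T) * (CM d s * R) := by
    intro i hi
    have h1 := hsum i (fun l => f' (l + 1)) (CM d s * R) hi (by positivity)
      (fun l hl => bf' (l + 1) (by omega))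
    have h2 := norm_add_le (p 0) ((τ : ℂ) • ∑ i ∈ Finset.range i, f' (i + 1))
    change ‖p 0 + (τ : ℂ) • ∑ i ∈ Finset.range i, f' (i + 1)‖ ≤ _
    linarith
  have bp : ∀ i, i ≤ m + 1 → ‖p i‖ ≤ (1 + T) * (CM d s * R) := by
    intro i hi
    have h1 := hsum i (fun l => f (l + 1)) (CM d s * R) hi (by positivity)
      (fun l hl => bf (l + 1) (by omega) (by omega))
    have h2 := norm_add_le (p 0) ((τ : ℂ) • ∑ i ∈ Finset.range i, f (i + 1))
    rw [hp i]
    linarith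
  -- differences
  have herri : ∀ i, 1 ≤ i → i ≤ m + 1 →
      sobNorm s (phiK d K ψK uK (t₀ + (i : ℝ) * τ) - phin τ ψn i)
      + pairNorm s (uK (t₀ + (i : ℝ) * τ) - un i) (udK (t₀ + (i : ℝ) * τ) - udn i) ≤ err :=
    fun i h1 h2 => le_errFull τ t₀ ψK uK udK ψn un udn h1 h2
  have df : ∀ i, 1 ≤ i → i ≤ m + 1 → ‖f' i - f i‖ ≤ CM d s * err := by
    intro i h1 h2
    apply hE1
    have h3 := herri i h1 h2
    have h4 := pairNorm_nonneg (s := s) (uK (t₀ + (i : ℝ) * τ) - un i)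
      (udK (t₀ + (i : ℝ) * τ) - udn i)
    change sobNorm s (phiK d K ψK uK (t₀ + (i : ℝ) * τ) - phin τ ψn i) ≤ err
    linarith
  have da : ‖a' (m + 1) - a (m + 1)‖ ≤ CM d s * err := by
    apply hE1
    have h3 := herri (m + 1) hn le_rfl
    obtain ⟨t, ht⟩ : ∃ t, t = t₀ + ((m + 1 : ℕ) : ℝ) * τ := ⟨_, rfl⟩
    rw [← ht] at h3
    have h4 := le_pairNorm1 (s := s) (uK t - un (m + 1)) (udK t - udn (m + 1))
    have h5 := sobNorm_nonneg s (phiK d K ψK uK t - phin τ ψn (m + 1))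
    have h6 := sobNorm_mono (isTrig_sub (hZK.1 t).2.1 (htr (m + 1)).2.1)
      (by linarith : s ≤ s + 1)
    change sobNorm s (uK (t₀ + ((m + 1 : ℕ) : ℝ) * τ) - un (m + 1)) ≤ err
    rw [← ht]
    linarith
  have db : ‖b' (m + 1) - b (m + 1)‖ ≤ CM d s * err := by
    apply hE1
    have h3 := herri (m + 1) hn le_rfl
    obtain ⟨t, ht⟩ : ∃ t, t = t₀ + ((m + 1 : ℕ) : ℝ) * τ := ⟨_, rfl⟩
    rw [← ht] at h3
    have h4 := le_pairNorm2 (s := s) (uK t - un (m + 1)) (udK t - udn (m + 1))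
    have h5 := sobNorm_nonneg s (phiK d K ψK uK t - phin τ ψn (m + 1))
    change sobNorm s (udK (t₀ + ((m + 1 : ℕ) : ℝ) * τ) - udn (m + 1)) ≤ err
    rw [← ht]
    linarith
  have dp : ∀ i, i ≤ m + 1 → ‖p' i - p i‖ ≤ (1 + T) * (CM d s * err) := by
    intro i hi
    have h0 : p' i - p i = (τ : ℂ) • ∑ l ∈ Finset.range i, (f' (l + 1) - f (l + 1)) := by
      rw [hp i, Finset.sum_sub_distrib, smul_sub]
      change (p 0 + (τ : ℂ) • ∑ i ∈ Finset.range i, f' (i + 1)) - _ = _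
      abel
    rw [h0]
    have h1 := hsum i (fun l => f' (l + 1) - f (l + 1)) (CM d s * err) hi (by positivity)
      (fun l hl => df (l + 1) (by omega) (by omega))
    have h2 : 0 ≤ CM d s * err := by positivity
    linarith
  have hτT : τ ≤ T := by
    have := hmono 1 (by omega)
    simpa using this
  have key := hlip K τ hτ hτT ((1 + T) * (CM d s * err))
    (a' (m + 1)) (b' (m + 1)) (f' (m + 1)) (p' (m + 1)) (p' m)
    (a (m + 1)) (b (m + 1)) (f (m + 1)) (p (m + 1)) (p m)
    (ba'.trans hBle) (bb'.trans hBle) ((bf' _ le_rfl).trans hBle) (bp' _ le_rfl)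
    (bp' m (by omega)) (ba.trans hBle) (bb.trans hBle) ((bf _ hn le_rfl).trans hBle)
    (bp _ le_rfl) (bp m (by omega)) (da.trans hEle) (db.trans hEle)
    ((df _ hn le_rfl).trans hEle) (dp _ le_rfl) (dp m (by omega))
  rw [← hstep, TA.norm_def, TA.norm_def, TA.val_sub, TA.val_sub, ← hstep'] at key
  have key2 : CM d s * sobNorm s (phihatSucc d K τ t₀ ψK uK udK (m + 1) - phin τ ψn (m + 1 + 1)) ≤
      CM d s * (sobNorm s (phiK d K ψK uK (t₀ + ((m + 1 : ℕ) : ℝ) * τ) - phin τ ψn (m + 1))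
        + C * (1 + T) * τ * err) := by
    refine key.trans (le_of_eq ?_)
    change CM d s * sobNorm s (phiK d K ψK uK (t₀ + ((m + 1 : ℕ) : ℝ) * τ) - phin τ ψn (m + 1))
      + _ = _
    ring
  exact le_of_mul_le_mul_left key2 hCM

end Zak
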